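/- arXiv:2310.16365 — 3 statements merged into one kernel-verified Lean document; each statement's English description precedes it below -/
import Mathlib

section
/- Let p ≥ 2d. Then the set of tuples w = (w_1,…,w_p) ∈ V^p for which the max filter map x ↦ (max_{g∈G} ⟨U_g w_1, x⟩, …, max_{g∈G} ⟨U_g w_p, x⟩) fails to separate G-orbits in V has Lebesgue measure zero and is nowhere dense in V^p. Consequently, for almost every w ∈ V^p, the equality max_{g∈G} ⟨U_g w_i, x⟩ = max_{g∈G} ⟨U_g w_i, y⟩ for all i ∈ {1,…,p} holds if and only if x ∼ y. -/
open scoped RealInnerProductSpace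
open MeasureTheory

/-- `coorbit U w x j` is the `j`-th largest entry (with multiplicity, `1 ≤ j ≤ N = |G|`)
of the `N`-tuple `(⟨U_g w, x⟩)_{g ∈ G}`. -/
noncomputable def coorbit {d : ℕ} {G : Type} [Group G] [Fintype G]
    (U : G →* (EuclideanSpace ℝ (Fin d) ≃ₗᵢ[ℝ] EuclideanSpace ℝ (Fin d)))
    (w x : EuclideanSpace ℝ (Fin d)) (j : ℕ) : ℝ :=
  ((Finset.univ.val.map fun g : G => ⟪(U g) w, x⟫).sort (· ≤ ·)).getD (Fintype.card G - j) 0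

/-- `dhat U x y = min_{g ∈ G} ‖x − U_g y‖`, the orbit distance. -/
noncomputable def dhat {d : ℕ} {G : Type} [Group G] [Fintype G]
    (U : G →* (EuclideanSpace ℝ (Fin d) ≃ₗᵢ[ℝ] EuclideanSpace ℝ (Fin d)))
    (x y : EuclideanSpace ℝ (Fin d)) : ℝ :=
  Finset.univ.inf' Finset.univ_nonempty fun g : G => ‖x - (U g) y‖

section MaxFilter

open Filter Topology

variable {E F W : Type*} [AddCommGroup E] [Module ℝ E]
  [NormedAddCommGroup F] [NormedSpace ℝ F]
  [NormedAddCommGroup W] [NormedSpace ℝ W]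

lemma isOpen_setOf_linearIndependent_apply [FiniteDimensional ℝ W] {ι : Type*} [Finite ι]
    (M : W →ₗ[ℝ] E →ₗ[ℝ] F) (x : ι → E) :
    IsOpen {w | LinearIndependent ℝ fun i => M w (x i)} := by
  have hcont : Continuous fun w => fun i => M w (x i) :=
    continuous_pi fun i => (M.flip (x i)).continuous_of_finiteDimensional
  exact isOpen_setOfPred_linearIndependent.preimage hcont

/-- Only finitely many points of an affine line in direction `w₀` violate linear independence of
the vectors `M w (x i)`, provided these are linearly independent at `w = w₀`. -/
lemma finite_setOf_not_linearIndependent_add_smul {ι : Type*} [Fintype ι]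
    (M : W →ₗ[ℝ] E →ₗ[ℝ] F) (x : ι → E) {w₀ : W}
    (h₀ : LinearIndependent ℝ fun i => M w₀ (x i)) (y : W) :
    {t : ℝ | ¬LinearIndependent ℝ fun i => M (y + t • w₀) (x i)}.Finite := by
  obtain ⟨Φ, hΦ⟩ := LinearMap.exists_leftInverse_of_injective
    (Fintype.linearCombination ℝ fun i => M w₀ (x i))
    (LinearMap.ker_eq_bot.2 (linearIndependent_iff_injective_fintypeLinearCombination.1 h₀))
  let T : Module.End ℝ (ι → ℝ) := Φ ∘ₗ Fintype.linearCombination ℝ fun i => M y (x i)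
  refine ((Module.End.finite_hasEigenvalue T).preimage neg_injective.injOn).subset fun t ht => ?_
  rw [Set.mem_ofPred_eq, Fintype.not_linearIndependent_iff] at ht
  obtain ⟨c, hc, i, hi⟩ := ht
  refine Module.End.hasEigenvalue_of_hasEigenvector (x := c)
    ⟨Module.End.mem_eigenspace_iff.2 ?_, fun h => hi (congrFun h i)⟩
  have hsum : Fintype.linearCombination ℝ (fun i => M y (x i)) c
      + t • Fintype.linearCombination ℝ (fun i => M w₀ (x i)) c = 0 := by
    rw [← hc]
    simp [Fintype.linearCombination_apply, Finset.smul_sum, Finset.sum_add_distrib, smul_comm t]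
  have hid : Φ (Fintype.linearCombination ℝ (fun i => M w₀ (x i)) c) = c := LinearMap.congr_fun hΦ c
  have := congrArg Φ hsum
  rw [map_add, map_smul, hid, map_zero] at this
  rw [neg_smul]
  exact eq_neg_of_add_eq_zero_left this

lemma measure_setOf_not_linearIndependent_eq_zero [FiniteDimensional ℝ W]
    [MeasurableSpace W] [BorelSpace W] (μ : Measure W) [μ.IsAddHaarMeasure] {ι : Type*} [Fintype ι]
    (M : W →ₗ[ℝ] E →ₗ[ℝ] F) (x : ι → E) {w₀ : W}
    (h₀ : LinearIndependent ℝ fun i => M w₀ (x i)) :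
    μ {w | ¬LinearIndependent ℝ fun i => M w (x i)} = 0 := by
  have := ae_mem_of_ae_add_linearMap_mem (LinearMap.toSpanSingleton ℝ W w₀) volume μ
    (isOpen_setOf_linearIndependent_apply M x).measurableSet fun y =>
      (finite_setOf_not_linearIndependent_add_smul M x h₀ y).measure_zero volume
  exact this

/-- If the rank of the linear family `M` is at most `r` everywhere and equals `r` at `w`, then every
derivative of the family maps the kernel at `w` into the range at `w`. -/
lemma apply_mem_span_of_rank_le [FiniteDimensional ℝ W] {r : ℕ} (M : W →ₗ[ℝ] E →ₗ[ℝ] F)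
    (hmax : ∀ (w : W) (x : Fin (r + 1) → E), ¬LinearIndependent ℝ fun i => M w (x i))
    {w : W} {x : Fin r → E} (hx : LinearIndependent ℝ fun i => M w (x i))
    {z : E} (hz : M w z = 0) (v : W) :
    M v z ∈ Submodule.span ℝ (Set.range fun i => M w (x i)) := by
  by_contra hv
  have hcons : LinearIndependent ℝ (Fin.cons (M v z) fun i => M w (x i) : Fin (r + 1) → F) :=
    linearIndependent_finCons.2 ⟨hx, hv⟩
  let f : ℝ → Fin (r + 1) → F := fun t => Fin.cons (M v z) fun i => M (w + t • v) (x i)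
  have hf : Continuous f := by
    refine continuous_pi fun i => Fin.cases ?_ (fun j => ?_) i
    · exact continuous_const
    · exact (M.flip (x j)).continuous_of_finiteDimensional.comp (by fun_prop)
  have hev : ∀ᶠ t in 𝓝 (0 : ℝ), LinearIndependent ℝ (f t) :=
    (isOpen_setOfPred_linearIndependent.preimage hf).mem_nhds (by simpa [f] using hcons)
  obtain ⟨t, ht, ht0⟩ := ((hev.filter_mono nhdsWithin_le_nhds).and
    (self_mem_nhdsWithin : {0}ᶜ ∈ 𝓝[≠] (0 : ℝ))).exists
  have ht0 : t ≠ 0 := ht0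
  refine hmax (w + t • v) (Fin.cons (t⁻¹ • z) x) ?_
  convert ht using 1
  funext i
  refine Fin.cases ?_ (fun j => ?_) i
  · simp [f, hz, smul_smul, ht0]
  · simp [f]

/-- The parameters `w` at which the kernel of `M w` contains a vector `z` such that `v ↦ M v z` is
onto lie in a closed null set, as soon as no `M w` is a surjection with nontrivial kernel. -/
lemma exists_isClosed_null_of_finrank_le [FiniteDimensional ℝ E] [FiniteDimensional ℝ F]
    [FiniteDimensional ℝ W] [MeasurableSpace W] [BorelSpace W]
    (μ : Measure W) [μ.IsAddHaarMeasure]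
    (hEF : Module.finrank ℝ E ≤ Module.finrank ℝ F) (M : W →ₗ[ℝ] E →ₗ[ℝ] F) :
    ∃ Z : Set W, IsClosed Z ∧ μ Z = 0 ∧
      ∀ w, ∀ z ≠ 0, M w z = 0 → Function.Surjective (fun v => M v z) → w ∈ Z := by
  classical
  let P : ℕ → Prop := fun r => ∃ (w : W) (x : Fin r → E), LinearIndependent ℝ fun i => M w (x i)
  have hP0 : P 0 := ⟨0, Fin.elim0, linearIndependent_empty_type⟩
  have hPle : ∀ r, P r → r ≤ Module.finrank ℝ F := fun r ⟨w, x, h⟩ => by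
    simpa using h.fintype_card_le_finrank
  let r := Nat.findGreatest P (Module.finrank ℝ F)
  obtain ⟨w₀, x, h₀⟩ : P r := Nat.findGreatest_spec (Nat.zero_le _) hP0
  have hmax : ∀ (w : W) (x : Fin (r + 1) → E), ¬LinearIndependent ℝ fun i => M w (x i) :=
    fun w x h => by
      have h1 : P (r + 1) := ⟨w, x, h⟩
      have := Nat.le_findGreatest (hPle _ h1) h1
      omega
  refine ⟨{w | ¬LinearIndependent ℝ fun i => M w (x i)},
    (isOpen_setOf_linearIndependent_apply M x).isClosed_compl,
    measure_setOf_not_linearIndependent_eq_zero μ M x h₀, fun w z hz hwz hsurj hw => hz ?_⟩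
  have hrange : Function.Surjective (M w) := fun f => by
    obtain ⟨v, rfl⟩ := hsurj f
    have := apply_mem_span_of_rank_le M hmax hw hwz v
    refine (Submodule.span_le.2 ?_ : _ ≤ LinearMap.range (M w)) this
    rintro _ ⟨i, rfl⟩
    exact LinearMap.mem_range_self _ _
  have heq : Module.finrank ℝ E = Module.finrank ℝ F :=
    hEF.antisymm (LinearMap.finrank_le_finrank_of_surjective hrange)
  have hinj := (LinearMap.injective_iff_surjective_of_finrank_eq_finrank heq).2 hrange
  exact hinj (by rw [hwz, map_zero])

variable {d : ℕ} {G : Type} [Group G]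
  (U : G →* (EuclideanSpace ℝ (Fin d) ≃ₗᵢ[ℝ] EuclideanSpace ℝ (Fin d)))

lemma apply_apply_eq_mul_apply (g h : G) (x : EuclideanSpace ℝ (Fin d)) :
    U g (U h x) = U (g * h) x := by
  rw [map_mul]
  rfl

lemma inner_apply_eq_inner_apply_inv (g : G) (w x : EuclideanSpace ℝ (Fin d)) :
    ⟪U g w, x⟫ = ⟪w, U g⁻¹ x⟫ := by
  rw [← (U g⁻¹).inner_map_map, apply_apply_eq_mul_apply, inv_mul_cancel, map_one]
  rfl

/-- The bilinear map `(w, (x, y)) ↦ (⟪U_{g i} w_i, x⟫ - ⟪U_{h i} w_i, y⟫)_i`. -/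
noncomputable def filterDifference {p : ℕ} (g h : Fin p → G) :
    (Fin p → EuclideanSpace ℝ (Fin d)) →ₗ[ℝ]
      (EuclideanSpace ℝ (Fin d) × EuclideanSpace ℝ (Fin d)) →ₗ[ℝ] (Fin p → ℝ) :=
  LinearMap.mk₂ ℝ (fun w z i => ⟪w i, U (g i)⁻¹ z.1 - U (h i)⁻¹ z.2⟫)
    (fun w w' z => by funext i; simp [inner_add_left])
    (fun c w z => by funext i; simp [inner_smul_left])
    (fun w z z' => by funext i; simp [inner_add_right, inner_sub_right]; ring)
    (fun c w z => by funext i; simp [inner_smul_right, inner_sub_right]; ring)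

lemma filterDifference_apply {p : ℕ} (g h : Fin p → G) (w : Fin p → EuclideanSpace ℝ (Fin d))
    (z : EuclideanSpace ℝ (Fin d) × EuclideanSpace ℝ (Fin d)) (i : Fin p) :
    filterDifference U g h w z i = ⟪w i, U (g i)⁻¹ z.1 - U (h i)⁻¹ z.2⟫ := rfl

lemma filterDifference_surjective {p : ℕ} (g h : Fin p → G)
    {x y : EuclideanSpace ℝ (Fin d)} (hxy : ¬∃ g : G, U g x = y) :
    Function.Surjective fun v => filterDifference U g h v (x, y) := fun c => by
  have hne : ∀ i, U (g i)⁻¹ x - U (h i)⁻¹ y ≠ 0 := fun i h0 => hxy ⟨h i * (g i)⁻¹, by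
    rw [← apply_apply_eq_mul_apply, sub_eq_zero.1 h0, apply_apply_eq_mul_apply, mul_inv_cancel,
      map_one]
    rfl⟩
  refine ⟨fun i => (c i / ‖U (g i)⁻¹ x - U (h i)⁻¹ y‖ ^ 2) • (U (g i)⁻¹ x - U (h i)⁻¹ y), ?_⟩
  funext i
  have := norm_ne_zero_iff.2 (hne i)
  simp only [filterDifference_apply, real_inner_smul_left, real_inner_self_eq_norm_sq]
  field_simp

lemma sup'_inner_apply_eq [Fintype G] (g : G) (w x : EuclideanSpace ℝ (Fin d)) :
    (Finset.univ.sup' Finset.univ_nonempty fun k : G => ⟪U k w, U g x⟫) =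
      Finset.univ.sup' Finset.univ_nonempty fun k : G => ⟪U k w, x⟫ := by
  have key : ∀ k, ⟪U k w, U g x⟫ = ⟪U (g⁻¹ * k) w, x⟫ := fun k => by
    rw [← apply_apply_eq_mul_apply, inner_apply_eq_inner_apply_inv U g⁻¹, inv_inv]
  refine le_antisymm (Finset.sup'_le _ _ fun k _ => ?_) (Finset.sup'_le _ _ fun k _ => ?_)
  · rw [key]
    exact Finset.le_sup' (fun k : G => ⟪U k w, x⟫) (Finset.mem_univ _)
  · have := Finset.le_sup' (fun k : G => ⟪U k w, U g x⟫) (Finset.mem_univ (g * k))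
    rwa [key, inv_mul_cancel_left] at this

/-- The templates whose max filter map fails to separate orbits lie in a closed null set. -/
lemma exists_isClosed_null_superset_maxFilter [Fintype G] {p : ℕ} (hp : 2 * d ≤ p) :
    ∃ Z : Set (Fin p → EuclideanSpace ℝ (Fin d)), IsClosed Z ∧ volume Z = 0 ∧
      {w | ∃ x y : EuclideanSpace ℝ (Fin d), (¬∃ g : G, U g x = y) ∧ ∀ i : Fin p,
        (Finset.univ.sup' Finset.univ_nonempty fun g : G => ⟪U g (w i), x⟫) =
        Finset.univ.sup' Finset.univ_nonempty fun g : G => ⟪U g (w i), y⟫} ⊆ Z := by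
  have hrank : Module.finrank ℝ (EuclideanSpace ℝ (Fin d) × EuclideanSpace ℝ (Fin d)) ≤
      Module.finrank ℝ (Fin p → ℝ) := by
    simp only [Module.finrank_prod, finrank_euclideanSpace, Fintype.card_fin,
      Module.finrank_fintype_fun_eq_card]
    omega
  choose Z hclosed hnull hmem using fun gh : (Fin p → G) × (Fin p → G) =>
    exists_isClosed_null_of_finrank_le (volume : Measure (Fin p → EuclideanSpace ℝ (Fin d)))
      hrank (filterDifference U gh.1 gh.2)
  refine ⟨⋃ gh, Z gh, isClosed_iUnion_of_finite hclosed, measure_iUnion_null hnull, ?_⟩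
  rintro w ⟨x, y, hxy, heq⟩
  choose g _ hg using fun i => Finset.exists_mem_eq_sup' Finset.univ_nonempty
    fun k : G => ⟪U k (w i), x⟫
  choose h _ hh using fun i => Finset.exists_mem_eq_sup' Finset.univ_nonempty
    fun k : G => ⟪U k (w i), y⟫
  refine Set.mem_iUnion.2 ⟨(g, h), hmem (g, h) w (x, y) ?_ ?_
    (filterDifference_surjective U g h hxy)⟩
  · intro h0
    obtain ⟨rfl, rfl⟩ := Prod.mk_eq_zero.1 h0
    exact hxy ⟨1, by simp⟩
  · funext i
    rw [filterDifference_apply, inner_sub_right, ← inner_apply_eq_inner_apply_inv,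
      ← inner_apply_eq_inner_apply_inv, Pi.zero_apply, sub_eq_zero, ← hg, ← hh, heq]

end MaxFilter

/-- for `p ≥ 2d`, the set of tuples `w ∈ V^p` for which the max filter map
`x ↦ (max_g ⟨U_g w_i, x⟩)_{i=1}^p` fails to separate `G`-orbits has Lebesgue measure zero
and is nowhere dense; consequently, for every `w` outside this bad set, equality of max
filters at `x` and `y` holds iff `x ∼ y`. -/
theorem stmt8 {d : ℕ} (hd : 2 ≤ d) {G : Type} [Group G] [Fintype G]
    (U : G →* (EuclideanSpace ℝ (Fin d) ≃ₗᵢ[ℝ] EuclideanSpace ℝ (Fin d)))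
    (p : ℕ) (hp : 2 * d ≤ p)
    (B : Set (Fin p → EuclideanSpace ℝ (Fin d)))
    (hB : B = {w : Fin p → EuclideanSpace ℝ (Fin d) | ∃ x y : EuclideanSpace ℝ (Fin d),
      (¬∃ g : G, (U g) x = y) ∧ ∀ i : Fin p,
        (Finset.univ.sup' Finset.univ_nonempty fun g : G => ⟪(U g) (w i), x⟫) =
        Finset.univ.sup' Finset.univ_nonempty fun g : G => ⟪(U g) (w i), y⟫}) :
    volume B = 0 ∧ IsNowhereDense B ∧
    ∀ w ∉ B, ∀ x y : EuclideanSpace ℝ (Fin d),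
      (∀ i : Fin p,
        (Finset.univ.sup' Finset.univ_nonempty fun g : G => ⟪(U g) (w i), x⟫) =
        Finset.univ.sup' Finset.univ_nonempty fun g : G => ⟪(U g) (w i), y⟫) ↔
      (∃ g : G, (U g) x = y) := by
  obtain ⟨Z, hZc, hZ0, hBZ⟩ := exists_isClosed_null_superset_maxFilter U hp
  rw [← hB] at hBZ
  refine ⟨measure_mono_null hBZ hZ0, (IsNowhereDense.of_isClosed_null hZc hZ0).mono hBZ, ?_⟩
  intro w hw x y
  constructor
  · intro h
    by_contra hxy
    exact hw (hB ▸ ⟨x, y, hxy, h⟩)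
  · rintro ⟨g, rfl⟩ i
    exact (sup'_inner_apply_eq U g (w i) x).symm
end

section
/- Let p ≥ 2d and fix group elements h_1,…,h_{2p} ∈ G. Then the set F_{h_1,…,h_{2p}} = {(w_1,…,w_p) ∈ V^p : ∃ x, y ∈ V with x ≁ y and ⟨w_i, U_{h_{2i−1}}x − U_{h_{2i}}y⟩ = 0 for all i ∈ {1,…,p}} has Lebesgue measure zero and is nowhere dense in V^p. -/
open scoped RealInnerProductSpace
open MeasureTheory

/-- If `v` is linearly independent, then `u + t • v` is linearly independent for all but finitely
many scalars `t`. -/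
theorem LinearIndependent.finite_setOf_not_add_smul {K E ι : Type*} [Field K] [AddCommGroup E]
    [Module K E] [Finite ι] {v : ι → E} (hv : LinearIndependent K v) (u : ι → E) :
    {t : K | ¬LinearIndependent K fun i => u i + t • v i}.Finite := by
  have := Fintype.ofFinite ι
  obtain ⟨f, hf⟩ := (Fintype.linearCombination K v).exists_leftInverse_of_injective
    (LinearMap.ker_eq_bot.2 (linearIndependent_iff_injective_fintypeLinearCombination.1 hv))
  set A : Module.End K (ι → K) := -(f ∘ₗ Fintype.linearCombination K u) with hA
  refine (Module.End.finite_spectrum A).subset fun t ht => ?_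
  by_contra hts
  refine ht (linearIndependent_iff_injective_fintypeLinearCombination.2 (LinearMap.ker_eq_bot.1 ?_))
  rw [LinearMap.ker_eq_bot']
  intro c hc
  by_contra hc0
  refine hts (Module.End.HasEigenvalue.mem_spectrum
    (Module.End.hasEigenvalue_of_hasEigenvector (x := c)
      ⟨Module.End.mem_eigenspace_iff.2 ?_, hc0⟩))
  have h1 : Fintype.linearCombination K u c + t • Fintype.linearCombination K v c = 0 := by
    rw [← hc]
    simp [Fintype.linearCombination_apply, Finset.smul_sum, Finset.sum_add_distrib, smul_comm t]
  have h2 : f (Fintype.linearCombination K v c) = c := LinearMap.congr_fun hf c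
  have h3 := congrArg f h1
  rw [map_add, map_smul, h2, map_zero] at h3
  simpa [hA] using (eq_neg_of_add_eq_zero_right h3).symm

section

variable {ι V E : Type*} [Finite ι]
  [NormedAddCommGroup V] [NormedSpace ℝ V] [FiniteDimensional ℝ V]
  [NormedAddCommGroup E] [NormedSpace ℝ E]

theorem isOpen_setOf_linearIndepOn_apply (L : ι → V →ₗ[ℝ] E) (I : Set ι) :
    IsOpen {w : ι → V | LinearIndepOn ℝ (fun i => L i (w i)) I} := by
  have hc : Continuous fun (w : ι → V) (i : I) => L i (w i) :=
    continuous_pi fun i =>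
      (L i).continuous_of_finiteDimensional.comp (continuous_apply (i : ι))
  exact isOpen_setOfPred_linearIndependent.preimage hc

/-- If `L i (w₀ i)`, `i ∈ I`, are linearly independent for one `w₀`, then `L i (w i)`, `i ∈ I`, are
linearly independent for almost every `w`. -/
theorem ae_linearIndepOn_apply [MeasurableSpace (ι → V)] [BorelSpace (ι → V)]
    (μ : Measure (ι → V)) [μ.IsAddHaarMeasure] (L : ι → V →ₗ[ℝ] E) {I : Set ι} {w₀ : ι → V}
    (h : LinearIndepOn ℝ (fun i => L i (w₀ i)) I) :
    ∀ᵐ w ∂μ, LinearIndepOn ℝ (fun i => L i (w i)) I := by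
  have := Fintype.ofFinite ι
  refine ae_mem_of_ae_add_linearMap_mem
    (s := {w | LinearIndepOn ℝ (fun i => L i (w i)) I})
    (LinearMap.toSpanSingleton ℝ (ι → V) w₀) volume μ
    (isOpen_setOf_linearIndepOn_apply L I).measurableSet fun w => ?_
  have hfin := LinearIndependent.finite_setOf_not_add_smul h fun i : I => L i (w i)
  filter_upwards [measure_eq_zero_iff_ae_notMem.1 (hfin.measure_zero volume)] with t ht
  rw [not_not] at ht
  simpa only [LinearIndepOn, LinearMap.toSpanSingleton_apply, Pi.add_apply, Pi.smul_apply, map_add,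
    map_smul] using ht

/-- If there are at least `dim E` maps `L i`, then for `w` outside a closed null set the span of the
vectors `L i (w i)` contains the range of some `L i`. -/
theorem exists_isClosed_null_forall_notMem_exists_range_le_span [Nonempty ι]
    [FiniteDimensional ℝ E] [MeasurableSpace (ι → V)] [BorelSpace (ι → V)]
    (μ : Measure (ι → V)) [μ.IsAddHaarMeasure] (L : ι → V →ₗ[ℝ] E)
    (hcard : Module.finrank ℝ E ≤ Nat.card ι) :
    ∃ Z : Set (ι → V), IsClosed Z ∧ μ Z = 0 ∧
      ∀ w ∉ Z, ∃ i, LinearMap.range (L i) ≤ Submodule.span ℝ (Set.range fun j => L j (w j)) := by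
  classical
  have := Fintype.ofFinite ι
  obtain ⟨I, hI⟩ := (Set.toFinite
    {I : Set ι | ∃ w : ι → V, LinearIndepOn ℝ (fun i => L i (w i)) I}).exists_maximal
      ⟨∅, 0, linearIndepOn_empty ℝ _⟩
  obtain ⟨w₀, hw₀⟩ := hI.prop
  refine ⟨{w | LinearIndepOn ℝ (fun i => L i (w i)) I}ᶜ,
    (isOpen_setOf_linearIndepOn_apply L I).isClosed_compl, ae_linearIndepOn_apply μ L hw₀,
    fun w hw => ?_⟩
  replace hw : LinearIndepOn ℝ (fun i => L i (w i)) I := not_not.1 hw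
  by_cases hIu : I = Set.univ
  · rw [hIu, linearIndepOn_univ_iff] at hw
    have hle := hw.fintype_card_le_finrank
    rw [Nat.card_eq_fintype_card] at hcard
    rw [hw.span_eq_top_of_card_eq_finrank (hle.antisymm hcard)]
    exact ⟨Classical.arbitrary ι, le_top⟩
  · obtain ⟨i, hi⟩ := (Set.ne_univ_iff_exists_notMem I).1 hIu
    refine ⟨i, ?_⟩
    rintro _ ⟨v, rfl⟩
    by_contra hv
    have heq : Set.EqOn (fun j => L j (w j)) (fun j => L j (Function.update w i v j)) I := by
      intro j hj
      have hji : j ≠ i := fun h => hi (h ▸ hj)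
      simp [hji]
    refine hi (hI.le_of_ge (y := insert i I) ⟨Function.update w i v, ?_⟩ (Set.subset_insert i I)
      (Set.mem_insert i I))
    rw [linearIndepOn_insert hi]
    refine ⟨hw.congr heq, fun hmem => hv ?_⟩
    rw [← heq.image_eq] at hmem
    simpa using Submodule.span_mono (Set.image_subset_range _ _) hmem

end

/-- for `p ≥ 2d` and fixed group elements `h₁,…,h_{2p} ∈ G` (recorded as
two `p`-tuples `a i = h_{2i−1}`, `b i = h_{2i}`), the set
`F = {w ∈ V^p : ∃ x ≁ y, ⟨w_i, U_{h_{2i−1}}x − U_{h_{2i}}y⟩ = 0 ∀i}` has Lebesgue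
measure zero and is nowhere dense in `V^p`. -/
theorem stmt10 {d : ℕ} (hd : 2 ≤ d) {G : Type} [Group G] [Fintype G]
    (U : G →* (EuclideanSpace ℝ (Fin d) ≃ₗᵢ[ℝ] EuclideanSpace ℝ (Fin d)))
    (p : ℕ) (hp : 2 * d ≤ p) (a b : Fin p → G)
    (F : Set (Fin p → EuclideanSpace ℝ (Fin d)))
    (hF : F = {w : Fin p → EuclideanSpace ℝ (Fin d) | ∃ x y : EuclideanSpace ℝ (Fin d),
      (¬∃ g : G, (U g) x = y) ∧ ∀ i : Fin p, ⟪w i, (U (a i)) x - (U (b i)) y⟫ = 0}) :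
    volume F = 0 ∧ IsNowhereDense F := by
  have : Nonempty (Fin p) := ⟨⟨0, by omega⟩⟩
  let L : Fin p → EuclideanSpace ℝ (Fin d) →ₗ[ℝ]
      EuclideanSpace ℝ (Fin d) × EuclideanSpace ℝ (Fin d) := fun i =>
    (U (a i)).symm.toLinearEquiv.toLinearMap.prod (-(U (b i)).symm.toLinearEquiv.toLinearMap)
  obtain ⟨Z, hZc, hZ0, hZ⟩ := exists_isClosed_null_forall_notMem_exists_range_le_span
    (volume : Measure (Fin p → EuclideanSpace ℝ (Fin d))) L (by simp; omega)
  have hFZ : F ⊆ Z := by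
    intro w hw
    rw [hF] at hw
    obtain ⟨x, y, hxy, hw⟩ := hw
    by_contra hwZ
    obtain ⟨i, hi⟩ := hZ w hwZ
    let φ : EuclideanSpace ℝ (Fin d) × EuclideanSpace ℝ (Fin d) →ₗ[ℝ] ℝ :=
      (innerₗ _ x).coprod (innerₗ _ y)
    have hφ : ∀ j v, φ (L j v) = ⟪v, U (a j) x - U (b j) y⟫ := by
      intro j v
      have h1 : ⟪x, (U (a j)).symm v⟫ = ⟪U (a j) x, v⟫ := by
        rw [← (U (a j)).inner_map_map, LinearIsometryEquiv.apply_symm_apply]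
      have h2 : ⟪y, (U (b j)).symm v⟫ = ⟪U (b j) y, v⟫ := by
        rw [← (U (b j)).inner_map_map, LinearIsometryEquiv.apply_symm_apply]
      rw [inner_sub_right, real_inner_comm _ v, real_inner_comm _ v, ← h1, ← h2]
      simp [φ, L, sub_eq_add_neg]
    have hker : Submodule.span ℝ (Set.range fun j => L j (w j)) ≤ LinearMap.ker φ := by
      rw [Submodule.span_le]
      rintro _ ⟨j, rfl⟩
      exact (hφ j (w j)).trans (hw j)
    have h0 : U (a i) x - U (b i) y = 0 := by
      rw [← inner_self_eq_zero (𝕜 := ℝ), ← hφ]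
      exact hker (hi ⟨_, rfl⟩)
    refine hxy ⟨(b i)⁻¹ * a i, ?_⟩
    have hb : U (b i)⁻¹ (U (b i) y) = (U (b i)⁻¹ * U (b i)) y := rfl
    have ha : U ((b i)⁻¹ * a i) x = U (b i)⁻¹ (U (a i) x) := by rw [map_mul]; rfl
    rw [ha, sub_eq_zero.1 h0, hb, ← map_mul, inv_mul_cancel, map_one]
    rfl
  exact ⟨measure_mono_null hFZ hZ0, (IsNowhereDense.of_isClosed_null hZc hZ0).mono hFZ⟩
end

section
/- For g ∈ G let r(g) = min_{λ∈ℝ} rank(U_g − λI) (the minimum is attained; it equals min over the real eigenvalues λ of U_g of rank(U_g − λI) when U_g has a real eigenvalue, and equals d otherwise). Let γ_1 ≥ γ_2 ≥ … ≥ γ_{N−1} be the decreasing rearrangement of the multiset {r(g) : g ∈ G, g ≠ 1}, and for 2 ≤ n ≤ N−1 set p_n = 2d − γ_{N−n+1}. Suppose p is an integer with p_n ≤ p ≤ 2d, and S ⊆ {1,…,N} × {1,…,p} satisfies |S_i| = n for 1 ≤ i ≤ 2d − p and |S_i| = 1 for 2d − p + 1 ≤ i ≤ p, where S_i = {j : (j,i)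 ∈ S}. Then the set of w = (w_1,…,w_p) ∈ V^p for which there exist x, y ∈ V with x ≁ y and Φ_{w_i,j}(x) = Φ_{w_i,j}(y) for all (j,i) ∈ S has Lebesgue measure zero and is nowhere dense in V^p. Consequently, for almost every w ∈ V^p, the coorbit map x ↦ (Φ_{w_i,j}(x))_{(j,i)∈S} takes equal values at x and y if and only if x ∼ y. -/
open scoped RealInnerProductSpace
open MeasureTheory

/-- `rankMin U g = min_{λ ∈ ℝ} rank (U_g − λ I)` (the minimum of the set of possible
ranks, which is attained since ranks are natural numbers). -/
noncomputable def rankMin {d : ℕ} {G : Type} [Group G] [Fintype G]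
    (U : G →* (EuclideanSpace ℝ (Fin d) ≃ₗᵢ[ℝ] EuclideanSpace ℝ (Fin d))) (g : G) : ℕ :=
  sInf {k : ℕ | ∃ c : ℝ, Module.finrank ℝ (LinearMap.range
    (((U g).toLinearEquiv : EuclideanSpace ℝ (Fin d) →ₗ[ℝ] EuclideanSpace ℝ (Fin d))
      - c • LinearMap.id)) = k}

/-- The increasingly sorted list of the multiset `{rankMin U g : g ∈ G, g ≠ 1}`.  The
`k`-th largest element `γ_k` (`1 ≤ k ≤ N−1`) of this multiset is
`(gammaSorted U).getD (N - 1 - k) 0`; in particular `γ_{N−n+1} = (gammaSorted U).getD (n-2) 0`. -/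
noncomputable def gammaSorted {d : ℕ} {G : Type} [Group G] [Fintype G] [DecidableEq G]
    (U : G →* (EuclideanSpace ℝ (Fin d) ≃ₗᵢ[ℝ] EuclideanSpace ℝ (Fin d))) : List ℕ :=
  ((Finset.univ.filter fun g : G => g ≠ 1).val.map (rankMin U)).sort (· ≤ ·)

/-- A real function on `σ → ℝ` given by a polynomial. -/
def PolyFun {σ : Type} (f : (σ → ℝ) → ℝ) : Prop :=
  ∃ P : MvPolynomial σ ℝ, ∀ s, MvPolynomial.eval s P = f s

namespace PolyFun

variable {σ : Type} {f g : (σ → ℝ) → ℝ}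

lemma const (c : ℝ) : PolyFun (fun _ : σ → ℝ => c) := ⟨MvPolynomial.C c, by simp⟩

lemma coord (i : σ) : PolyFun (fun s : σ → ℝ => s i) := ⟨MvPolynomial.X i, by simp⟩

lemma add (hf : PolyFun f) (hg : PolyFun g) : PolyFun fun s => f s + g s := by
  obtain ⟨P, hP⟩ := hf
  obtain ⟨Q, hQ⟩ := hg
  exact ⟨P + Q, fun s => by simp [hP, hQ]⟩

lemma mul (hf : PolyFun f) (hg : PolyFun g) : PolyFun fun s => f s * g s := by
  obtain ⟨P, hP⟩ := hf
  obtain ⟨Q, hQ⟩ := hg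
  exact ⟨P * Q, fun s => by simp [hP, hQ]⟩

lemma neg (hf : PolyFun f) : PolyFun fun s => - f s := by
  simpa using (const (-1)).mul hf

lemma sub (hf : PolyFun f) (hg : PolyFun g) : PolyFun fun s => f s - g s := by
  simpa [sub_eq_add_neg] using hf.add hg.neg

lemma pow (hf : PolyFun f) (n : ℕ) : PolyFun fun s => f s ^ n := by
  obtain ⟨P, hP⟩ := hf
  exact ⟨P ^ n, fun s => by simp [hP]⟩

lemma sum {ι : Type} (t : Finset ι) {F : ι → (σ → ℝ) → ℝ} (h : ∀ i ∈ t, PolyFun (F i)) :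
    PolyFun fun s => ∑ i ∈ t, F i s := by
  classical
  induction t using Finset.induction_on with
  | empty => simpa using const (σ := σ) 0
  | insert a t ha ih =>
    simp only [Finset.sum_insert ha]
    exact (h a (by simp)).add (ih fun i hi => h i (by simp [hi]))

lemma comp {τ : Type} (hf : PolyFun f) {φ : (τ → ℝ) → σ → ℝ}
    (hφ : ∀ i, PolyFun fun s => φ s i) : PolyFun fun s => f (φ s) := by
  obtain ⟨P, hP⟩ := hf
  choose Q hQ using hφ
  refine ⟨MvPolynomial.bind₁ Q P, fun s => ?_⟩
  change _ = f (φ s)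
  rw [← hP, MvPolynomial.eval, MvPolynomial.eval₂Hom_bind₁]
  congr 2
  funext i
  exact hQ i s

/-- Polynomial functions form an integral domain. -/
lemma eq_zero_of_mul_eq_zero (hf : PolyFun f) (hg : PolyFun g) (h : ∀ s, f s * g s = 0)
    (hne : ∃ s, f s ≠ 0) (s : σ → ℝ) : g s = 0 := by
  obtain ⟨P, hP⟩ := hf
  obtain ⟨Q, hQ⟩ := hg
  have hPQ : P * Q = 0 := MvPolynomial.funext fun s => by simp [hP, hQ, h]
  rcases mul_eq_zero.1 hPQ with h0 | h0
  · obtain ⟨t, ht⟩ := hne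
    exact absurd (by rw [← hP, h0, map_zero]) ht
  · rw [← hQ, h0, map_zero]

end PolyFun

/-- More polynomials than variables, restricted to a hypersurface, with one slot of room:
the image of the hypersurface lies in the zero set of a nonzero polynomial. -/
lemma exists_poly_vanishing_on_image {σ τ : Type} [Fintype σ] [Fintype τ]
    (hcard : Fintype.card σ ≤ Fintype.card τ) {h : (σ → ℝ) → ℝ} (hh : PolyFun h)
    (hne : ∃ s, h s ≠ 0) {f : (σ → ℝ) → τ → ℝ} (hf : ∀ t, PolyFun fun s => f s t) :
    ∃ P : MvPolynomial τ ℝ, P ≠ 0 ∧ ∀ s, h s = 0 → MvPolynomial.eval (f s) P = 0 := by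
  classical
  obtain ⟨H, hH⟩ := hh
  choose Q hQ using hf
  have hdep : ¬ AlgebraicIndependent ℝ (fun o : Option τ => o.elim H Q) := by
    intro hind
    have h1 := hind.lift_cardinalMk_le_trdeg
    rw [MvPolynomial.trdeg_of_isDomain] at h1
    simp only [Cardinal.mk_fintype, Cardinal.lift_natCast, Fintype.card_option,
      Nat.cast_le] at h1
    omega
  rw [algebraicIndependent_iff] at hdep
  push Not at hdep
  obtain ⟨R₀, hR₀, hR₀0⟩ := hdep
  have hvan : ∀ s, MvPolynomial.eval (fun o : Option τ => o.elim (h s) (f s)) R₀ = 0 := by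
    intro s
    have h3 : MvPolynomial.eval s (MvPolynomial.bind₁ (fun o : Option τ => o.elim H Q) R₀) = 0 :=
      (congrArg (MvPolynomial.eval s) hR₀).trans (map_zero _)
    rw [MvPolynomial.eval, MvPolynomial.eval₂Hom_bind₁] at h3
    rw [← h3, MvPolynomial.eval]
    congr 2
    funext o
    cases o with
    | none => exact (hH s).symm
    | some t => exact (hQ t s).symm
  set R := MvPolynomial.optionEquivLeft ℝ τ R₀ with hRdef
  have hR0 : R ≠ 0 := by simpa [hRdef] using hR₀0
  obtain ⟨R', hR', hR'0⟩ := Polynomial.exists_eq_pow_rootMultiplicity_mul_and_not_dvd R hR0 0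
  set k := R.rootMultiplicity 0
  set R₁ := (MvPolynomial.optionEquivLeft ℝ τ).symm R' with hR₁
  have hval : ∀ s, MvPolynomial.eval (fun o : Option τ => o.elim (h s) (f s)) R₁ =
      (R'.map (MvPolynomial.eval (f s))).eval (h s) := by
    intro s
    rw [MvPolynomial.optionEquivLeft_elim_eval, hR₁, AlgEquiv.apply_symm_apply]
  have hR₁0 : ∀ s, MvPolynomial.eval (fun o : Option τ => o.elim (h s) (f s)) R₁ = 0 := by
    have hpoly : ∀ o : Option τ, PolyFun fun s => o.elim (h s) (f s) := by
      intro o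
      cases o with
      | none => exact ⟨H, hH⟩
      | some t => exact ⟨Q t, hQ t⟩
    refine PolyFun.eq_zero_of_mul_eq_zero (f := fun s => h s ^ k) (PolyFun.pow ⟨H, hH⟩ k)
      (PolyFun.comp ⟨R₁, fun _ => rfl⟩ hpoly) (fun s => ?_) ?_
    · rw [hval, ← hvan s, MvPolynomial.optionEquivLeft_elim_eval, ← hRdef, hR']
      simp
    · obtain ⟨s, hs⟩ := hne
      exact ⟨s, pow_ne_zero _ hs⟩
  refine ⟨R'.coeff 0, fun h0 => hR'0 ?_, fun s hs => ?_⟩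
  · simpa [Polynomial.X_dvd_iff] using h0
  · have := hR₁0 s
    rw [hval, hs, ← Polynomial.coeff_zero_eq_eval_zero, Polynomial.coeff_map] at this
    exact this

/-- A polynomial not vanishing identically has a Lebesgue-null zero set (in any linear
coordinates). -/
lemma volume_zero_of_polynomial {E τ : Type} [NormedAddCommGroup E] [NormedSpace ℝ E]
    [FiniteDimensional ℝ E] [MeasurableSpace E] [BorelSpace E] (μ : Measure E)
    [μ.IsAddHaarMeasure] (e : E → τ → ℝ) (he : Continuous e)
    (hadd : ∀ x y, e (x + y) = e x + e y) (hsmul : ∀ (c : ℝ) x, e (c • x) = c • e x)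
    (P : MvPolynomial τ ℝ) (w₀ : E) (hw₀ : MvPolynomial.eval (e w₀) P ≠ 0) :
    μ {w | MvPolynomial.eval (e w) P = 0} = 0 := by
  set Z : Set E := {w | MvPolynomial.eval (e w) P = 0} with hZ
  have hZc : IsClosed Z :=
    isClosed_eq ((MvPolynomial.continuous_eval P).comp he) continuous_const
  set C : Set (E × ℝ) := {q | w₀ + q.2 • (q.1 - w₀) ∈ Z} with hC
  have hCc : IsClosed C := hZc.preimage (by fun_prop)
  have hfib : ∀ z : E, volume (Prod.mk z ⁻¹' C) = 0 := by
    intro z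
    set q : Polynomial ℝ := MvPolynomial.aeval
      (fun t => Polynomial.C (e w₀ t) + Polynomial.X * Polynomial.C (e (z - w₀) t)) P with hq
    have hqe : ∀ t : ℝ, q.eval t = MvPolynomial.eval (e (w₀ + t • (z - w₀))) P := by
      intro t
      rw [hq, ← Polynomial.coe_evalRingHom, MvPolynomial.aeval_def,
        MvPolynomial.hom_eval₂, MvPolynomial.eval, MvPolynomial.coe_eval₂Hom]
      congr 1
      · ext; simp
      · funext i; rw [hadd, hsmul]; simp; ring
    have hq0 : q ≠ 0 := by
      intro h0
      apply hw₀
      simpa [h0] using (hqe 0).symm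
    have hsub : Prod.mk z ⁻¹' C ⊆ (q.roots.toFinset : Set ℝ) := by
      intro t ht
      have : q.eval t = 0 := by rw [hqe]; exact ht
      simp [hq0, this]
    exact measure_mono_null hsub (Finset.measure_zero _ _)
  have hprod : (μ.prod volume) C = 0 := by
    rw [Measure.measure_prod_null hCc.measurableSet]
    exact Filter.Eventually.of_forall hfib
  have hae := Measure.ae_ae_of_ae_prod (μ := (volume : Measure ℝ)) (ν := μ)
    (p := fun q : ℝ × E => (q.2, q.1) ∉ C) (by
      have h1 := (Measure.measurePreserving_swap (μ := (volume : Measure ℝ)) (ν := μ)).quasiMeasurePreserving.ae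
        (p := fun q => q ∉ C) (measure_eq_zero_iff_ae_notMem.1 hprod)
      exact h1)
  have hpos : ∃ᵐ t ∂(volume : Measure ℝ), 0 < t := by
    intro h
    have h2 : volume (Set.Ioi (0 : ℝ)) = 0 := by
      refine measure_mono_null (fun t ht => ?_) (ae_iff.1 h)
      simpa using ht
    simp at h2
  obtain ⟨t, ht0, ht⟩ := (hpos.and_eventually hae).exists
  have hset : μ {z | w₀ + t • (z - w₀) ∈ Z} = 0 := by
    rw [measure_eq_zero_iff_ae_notMem]
    exact ht
  have hZimg : Z ⊆ (fun z => w₀ + t • (z - w₀)) '' {z | w₀ + t • (z - w₀) ∈ Z} := by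
    intro w hw
    have hw' : w₀ + t • ((w₀ + t⁻¹ • (w - w₀)) - w₀) = w := by
      rw [add_sub_cancel_left, smul_smul, mul_inv_cancel₀ ht0.ne', one_smul, add_sub_cancel]
    exact ⟨w₀ + t⁻¹ • (w - w₀), by
      show _ ∈ Z
      rw [hw']
      exact hw, hw'⟩
  refine measure_mono_null hZimg ?_
  have : (fun z : E => w₀ + t • (z - w₀)) = AffineMap.homothety w₀ t := by
    funext z; simp [AffineMap.homothety_apply, add_comm]
  rw [this, Measure.addHaar_image_homothety, hset, mul_zero]

/-- Contained in the zero set of a nonzero polynomial in the `p * d` coordinates. -/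
def PolySmall {d p : ℕ} (F : Set (Fin p → EuclideanSpace ℝ (Fin d))) : Prop :=
  ∃ P : MvPolynomial (Fin p × Fin d) ℝ, P ≠ 0 ∧
    ∀ w ∈ F, MvPolynomial.eval (fun q => w q.1 q.2) P = 0

namespace PolySmall

variable {d p : ℕ} {F F' : Set (Fin p → EuclideanSpace ℝ (Fin d))}

lemma mono (h : PolySmall F') (hF : F ⊆ F') : PolySmall F := by
  obtain ⟨P, hP, hv⟩ := h
  exact ⟨P, hP, fun w hw => hv w (hF hw)⟩

lemma union (h : PolySmall F) (h' : PolySmall F') : PolySmall (F ∪ F') := by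
  obtain ⟨P, hP, hv⟩ := h
  obtain ⟨Q, hQ, hv'⟩ := h'
  refine ⟨P * Q, mul_ne_zero hP hQ, ?_⟩
  rintro w (hw | hw)
  · simp [hv w hw]
  · simp [hv' w hw]

lemma iUnion {ι : Type} [Finite ι] {A : ι → Set (Fin p → EuclideanSpace ℝ (Fin d))}
    (h : ∀ i, PolySmall (A i)) : PolySmall (⋃ i, A i) := by
  cases nonempty_fintype ι
  choose P hP hv using h
  refine ⟨∏ i, P i, Finset.prod_ne_zero_iff.2 fun i _ => hP i, fun w hw => ?_⟩
  obtain ⟨i, hi⟩ := Set.mem_iUnion.1 hw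
  rw [map_prod]
  exact Finset.prod_eq_zero (Finset.mem_univ i) (hv i w hi)

lemma empty : PolySmall (∅ : Set (Fin p → EuclideanSpace ℝ (Fin d))) :=
  ⟨1, one_ne_zero, by simp⟩

lemma null_and_nowhereDense (h : PolySmall F) : volume F = 0 ∧ IsNowhereDense F := by
  obtain ⟨P, hP, hv⟩ := h
  set e : (Fin p → EuclideanSpace ℝ (Fin d)) → Fin p × Fin d → ℝ := fun w q => w q.1 q.2
  have he : Continuous e := by fun_prop
  set Z : Set (Fin p → EuclideanSpace ℝ (Fin d)) := {w | MvPolynomial.eval (e w) P = 0} with hZ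
  have hex : ∃ w, MvPolynomial.eval (e w) P ≠ 0 := by
    by_contra! hcon
    refine hP (MvPolynomial.funext fun s => ?_)
    rw [map_zero, ← hcon fun i => WithLp.toLp 2 fun j => s (i, j)]
  obtain ⟨w₀, hw₀⟩ := hex
  have hZ0 : volume Z = 0 := volume_zero_of_polynomial volume e he
    (fun _ _ => rfl) (fun _ _ => rfl) P w₀ hw₀
  have hZc : IsClosed Z :=
    isClosed_eq ((MvPolynomial.continuous_eval P).comp he) continuous_const
  refine ⟨measure_mono_null (fun w hw => hv w hw) hZ0, ?_⟩
  refine IsNowhereDense.mono (t := F) (s := Z) (fun w hw => hv w hw) ?_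
  rw [hZc.isNowhereDense_iff]
  exact Measure.interior_eq_empty_of_null hZ0

end PolySmall

/-- Euclidean space of dimension `d`. -/
abbrev Euc (d : ℕ) : Type := EuclideanSpace ℝ (Fin d)

lemma inner_eq_sum {d : ℕ} (w u : Euc d) : ⟪w, u⟫ = ∑ j, w j * u j := by
  simp [PiLp.inner_apply, mul_comm]

/-- A vector-valued function with polynomial coordinates. -/
def VPoly {σ : Type} {d : ℕ} (v : (σ → ℝ) → Euc d) : Prop :=
  ∀ j, PolyFun fun s => v s j

namespace VPoly

variable {σ : Type} {d : ℕ} {u v : (σ → ℝ) → Euc d} {f : (σ → ℝ) → ℝ}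

lemma const (x : Euc d) : VPoly (fun _ : σ → ℝ => x) := fun j => PolyFun.const (x j)

lemma add (hu : VPoly u) (hv : VPoly v) : VPoly fun s => u s + v s :=
  fun j => (hu j).add (hv j)

lemma sub (hu : VPoly u) (hv : VPoly v) : VPoly fun s => u s - v s :=
  fun j => (hu j).sub (hv j)

lemma smul (hf : PolyFun f) (hv : VPoly v) : VPoly fun s => f s • v s :=
  fun j => hf.mul (hv j)

lemma sum {ι : Type} (t : Finset ι) {F : ι → (σ → ℝ) → Euc d} (h : ∀ i ∈ t, VPoly (F i)) :
    VPoly fun s => ∑ i ∈ t, F i s := by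
  intro j
  simp only [WithLp.ofLp_sum, Finset.sum_apply]
  exact PolyFun.sum t fun i hi => h i hi j

lemma toLp {f : (σ → ℝ) → Fin d → ℝ} (hf : ∀ j, PolyFun fun s => f s j) :
    VPoly fun s => WithLp.toLp 2 (f s) := hf

lemma map {e : ℕ} (A : Euc e →ₗ[ℝ] Euc d) {v : (σ → ℝ) → Euc e} (hv : VPoly v) :
    VPoly fun s => A (v s) := by
  have h : (fun s => A (v s)) = fun s => ∑ i, v s i • A (EuclideanSpace.single i 1) := by
    funext s
    conv_lhs => rw [← (EuclideanSpace.basisFun (Fin e) ℝ).sum_repr (v s)]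
    simp
  rw [h]
  exact sum _ fun i _ => smul (hv i) (const _)

lemma comp {τ : Type} (hv : VPoly v) {φ : (τ → ℝ) → σ → ℝ}
    (hφ : ∀ i, PolyFun fun s => φ s i) : VPoly fun s => v (φ s) :=
  fun j => (hv j).comp hφ

end VPoly

/-- All `2 × 2` minors vanish: linear dependence of two vectors. -/
def Par {d : ℕ} (u v : Euc d) : Prop := ∀ j l, u j * v l = u l * v j

lemma neg_sum_ite_div {d : ℕ} (w u : Fin d → ℝ) (k : Fin d) (hk : u k ≠ 0)
    (h : ∑ j, w j * u j = 0) : -∑ j, (if j = k then 0 else w j / u k) * u j = w k := by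
  have h1 : ∀ j, (if j = k then 0 else w j / u k) * u j =
      w j * u j / u k - if j = k then w k else 0 := by
    intro j
    split_ifs with hj
    · subst hj; field_simp; ring
    · ring
  simp only [h1, Finset.sum_sub_distrib, ← Finset.sum_div, h]
  simp

lemma incidence_chart {σ : Type} [Fintype σ] {d p : ℕ} (T : Finset (Fin p))
    (hcard : Fintype.card σ ≤ p + T.card) {h : (σ → ℝ) → ℝ} (hh : PolyFun h)
    (hne : ∃ s, h s ≠ 0) {u u' : Fin p → (σ → ℝ) → Euc d} (hu : ∀ i, VPoly (u i))
    (hu' : ∀ i, VPoly (u' i)) (κ l : Fin p → Fin d) (hκl : ∀ i ∈ T, l i ≠ κ i) :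
    PolySmall {w : Fin p → Euc d | ∃ s, h s = 0 ∧
      (∀ i, u i s (κ i) ≠ 0 ∧ ⟪w i, u i s⟫ = 0) ∧
      ∀ i ∈ T, u i s (κ i) * u' i s (l i) - u' i s (κ i) * u i s (l i) ≠ 0 ∧
        ⟪w i, u' i s⟫ = 0} := by
  classical
  let τ := {q : Fin p × Fin d // q.2 ≠ κ q.1 ∧ (q.1 ∈ T → q.2 ≠ l q.1)}
  have hτ : Fintype.card (σ ⊕ τ) ≤ Fintype.card (Fin p × Fin d) := by
    have h1 : Fintype.card (Fin p ⊕ T) ≤ Fintype.card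
        {q : Fin p × Fin d // ¬ (q.2 ≠ κ q.1 ∧ (q.1 ∈ T → q.2 ≠ l q.1))} := by
      refine Fintype.card_le_of_injective (Sum.elim
        (fun i => ⟨(i, κ i), by simp⟩) (fun i => ⟨(i.1, l i.1), by simp⟩)) ?_
      rintro (i | i) (j | j) hij
      · simp at hij; simp [hij]
      · simp at hij
        obtain ⟨rfl, h2⟩ := hij
        exact absurd h2.symm (hκl _ j.2)
      · simp at hij
        obtain ⟨rfl, h2⟩ := hij
        exact absurd h2 (hκl _ i.2)
      · simp only [Sum.elim_inr, Subtype.mk.injEq, Prod.mk.injEq] at hij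
        exact congrArg Sum.inr (Subtype.ext hij.1)
    have h2 := Fintype.card_subtype_compl
      (fun q : Fin p × Fin d => q.2 ≠ κ q.1 ∧ (q.1 ∈ T → q.2 ≠ l q.1))
    have h3 := Fintype.card_subtype_le
      (fun q : Fin p × Fin d => q.2 ≠ κ q.1 ∧ (q.1 ∈ T → q.2 ≠ l q.1))
    rw [Fintype.card_sum, Fintype.card_fin, Fintype.card_coe] at h1
    have h4 : Fintype.card τ = Fintype.card
        {q : Fin p × Fin d // q.2 ≠ κ q.1 ∧ (q.1 ∈ T → q.2 ≠ l q.1)} := rfl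
    rw [Fintype.card_sum, h4]
    omega
  let a : (σ ⊕ τ → ℝ) → σ → ℝ := fun s x => s (Sum.inl x)
  let v : (σ ⊕ τ → ℝ) → Fin p → Fin d → ℝ := fun s i j =>
    if hq : j ≠ κ i ∧ (i ∈ T → j ≠ l i) then s (Sum.inr ⟨(i, j), hq⟩) else 0
  let b : (σ → ℝ) → Fin p → Fin d → ℝ := fun s i m =>
    u i s (κ i) * u' i s m - u' i s (κ i) * u i s m
  let y : (σ ⊕ τ → ℝ) → Fin p → Fin d → ℝ := fun s i m =>
    if i ∈ T then (if m = l i then -∑ j, v s i j * b (a s) i j else b (a s) i (l i) * v s i m)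
    else v s i m
  let f : (σ ⊕ τ → ℝ) → Fin p × Fin d → ℝ := fun s q =>
    if q.2 = κ q.1 then -∑ j, y s q.1 j * u q.1 (a s) j
    else u q.1 (a s) (κ q.1) * y s q.1 q.2
  have ha : ∀ x, PolyFun fun s => a s x := fun x => PolyFun.coord (Sum.inl x)
  have hv : ∀ i j, PolyFun fun s => v s i j := by
    intro i j
    by_cases hq : j ≠ κ i ∧ (i ∈ T → j ≠ l i)
    · simpa only [v, dif_pos hq] using PolyFun.coord _
    · simpa only [v, dif_neg hq] using PolyFun.const 0
  have hua : ∀ i j, PolyFun fun s => u i (a s) j := fun i j => (hu i j).comp ha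
  have hua' : ∀ i j, PolyFun fun s => u' i (a s) j := fun i j => (hu' i j).comp ha
  have hb : ∀ i j, PolyFun fun s => b (a s) i j := fun i j =>
    ((hua i _).mul (hua' i _)).sub ((hua' i _).mul (hua i _))
  have hy : ∀ i m, PolyFun fun s => y s i m := by
    intro i m
    simp only [y]
    split_ifs
    · exact (PolyFun.sum _ fun j _ => (hv i j).mul (hb i j)).neg
    · exact (hb i _).mul (hv i m)
    · exact hv i m
  have hf : ∀ q, PolyFun fun s => f s q := by
    intro q
    simp only [f]
    split_ifs
    · exact (PolyFun.sum _ fun j _ => (hy _ j).mul (hua _ j)).neg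
    · exact (hua _ _).mul (hy _ _)
  have hne' : ∃ s, h (a s) ≠ 0 := by
    obtain ⟨s, hs⟩ := hne
    exact ⟨Sum.elim s fun _ => 0, hs⟩
  obtain ⟨P, hP, hPv⟩ := exists_poly_vanishing_on_image hτ (hh.comp ha) hne' hf
  refine ⟨P, hP, ?_⟩
  rintro w ⟨s, hs, h1, h2⟩
  let S : σ ⊕ τ → ℝ := Sum.elim s fun q =>
    w q.1.1 q.1.2 / u q.1.1 s (κ q.1.1) / if q.1.1 ∈ T then b s q.1.1 (l q.1.1) else 1
  have haS : a S = s := rfl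
  have hkey := hPv S (by rw [haS]; exact hs)
  have hyS : ∀ i m, m ≠ κ i → y S i m = w i m / u i s (κ i) := by
    intro i m hm
    by_cases hi : i ∈ T
    · have hbl : b s i (l i) ≠ 0 := (h2 i hi).1
      have hvS : ∀ j, j ≠ κ i → v S i j =
          if j = l i then 0 else w i j / u i s (κ i) / b s i (l i) := by
        intro j hj
        by_cases hjl : j = l i
        · simp [v, hi, hjl]
        · simp [v, hi, hjl, hj, S]
      by_cases hml : m = l i
      · simp only [y, if_pos hi, if_pos hml, haS]
        rw [hml, ← neg_sum_ite_div (fun j => w i j / u i s (κ i)) (b s i) (l i) hbl]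
        · congr 1
          refine Finset.sum_congr rfl fun j _ => ?_
          by_cases hj : j = κ i
          · have : b s i j = 0 := by simp only [b, hj]; ring
            rw [this, mul_zero, mul_zero]
          · rw [hvS j hj]
        · have e1 := (h1 i).2
          have e2 := (h2 i hi).2
          rw [inner_eq_sum] at e1 e2
          have : ∀ j, w i j / u i s (κ i) * b s i j =
              w i j * u' i s j - u' i s (κ i) / u i s (κ i) * (w i j * u i s j) := by
            intro j
            have := (h1 i).1
            simp only [b]
            field_simp
          simp only [this, Finset.sum_sub_distrib, ← Finset.mul_sum, e1, e2]
          simp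
      · simp only [y, if_pos hi, if_neg hml, haS]
        rw [hvS m hm, if_neg hml]
        field_simp
    · simp [y, hi, v, hm, S]
  have hyκ : ∀ i, y S i (κ i) = 0 := by
    intro i
    by_cases hi : i ∈ T
    · simp [y, hi, (hκl i hi).symm, v]
    · simp [y, hi, v]
  have hfS : f S = fun q => w q.1 q.2 := by
    funext ⟨i, m⟩
    by_cases hm : m = κ i
    · simp only [f, if_pos hm, haS]
      have e1 := (h1 i).2
      rw [inner_eq_sum] at e1
      rw [hm, ← neg_sum_ite_div (fun j => w i j) (fun j => u i s j) (κ i) (h1 i).1 e1]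
      congr 1
      refine Finset.sum_congr rfl fun j _ => ?_
      by_cases hj : j = κ i
      · rw [if_pos hj, hj, hyκ]
      · rw [if_neg hj, hyS i j hj]
    · simp only [f, if_neg hm, haS]
      rw [hyS i m hm]
      have := (h1 i).1
      field_simp
  rw [hfS] at hkey
  exact hkey

/-- Vectors constrained by a family of hyperplane conditions with few parameters. -/
lemma incidence {σ : Type} [Fintype σ] {d p : ℕ} (T : Finset (Fin p))
    (hcard : Fintype.card σ ≤ p + T.card) {h : (σ → ℝ) → ℝ} (hh : PolyFun h)
    (hne : ∃ s, h s ≠ 0) {u u' : Fin p → (σ → ℝ) → Euc d} (hu : ∀ i, VPoly (u i))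
    (hu' : ∀ i, VPoly (u' i)) :
    PolySmall {w : Fin p → Euc d | ∃ s, h s = 0 ∧ (∀ i, u i s ≠ 0 ∧ ⟪w i, u i s⟫ = 0) ∧
      ∀ i ∈ T, ¬ Par (u i s) (u' i s) ∧ ⟪w i, u' i s⟫ = 0} := by
  classical
  rcases Nat.eq_zero_or_pos d with rfl | hd
  · rcases Nat.eq_zero_or_pos p with rfl | hp
    · have hσ : IsEmpty σ := by
        rw [← Fintype.card_eq_zero_iff]
        have := Finset.eq_empty_of_isEmpty T
        simp [this] at hcard
        simpa using hcard
      refine PolySmall.empty.mono ?_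
      rintro w ⟨s, hs, -⟩
      obtain ⟨s', hs'⟩ := hne
      exact absurd (by rw [← hs]; congr 1; exact Subsingleton.elim _ _) hs'
    · refine PolySmall.empty.mono ?_
      rintro w ⟨s, hs, h1, -⟩
      exact absurd (Subsingleton.elim _ _) (h1 ⟨0, hp⟩).1
  have hchart : ∀ q : (Fin p → Fin d) × (Fin p → Fin d),
      PolySmall {w : Fin p → Euc d | ∃ s, h s = 0 ∧
      (∀ i, u i s (q.1 i) ≠ 0 ∧ ⟪w i, u i s⟫ = 0) ∧
      ∀ i ∈ T, u i s (q.1 i) * u' i s (q.2 i) - u' i s (q.1 i) * u i s (q.2 i) ≠ 0 ∧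
        ⟪w i, u' i s⟫ = 0} := by
    rintro ⟨κ, l⟩
    by_cases hκl : ∀ i ∈ T, l i ≠ κ i
    · exact incidence_chart T hcard hh hne hu hu' κ l hκl
    · push Not at hκl
      obtain ⟨i, hi, hκl⟩ := hκl
      refine PolySmall.empty.mono ?_
      rintro w ⟨s, hs, -, h2⟩
      refine absurd ?_ (h2 i hi).1
      simp only [hκl]
      ring
  refine (PolySmall.iUnion hchart).mono ?_
  rintro w ⟨s, hs, h1, h2⟩
  have hκ : ∀ i, ∃ κ l : Fin d, u i s κ ≠ 0 ∧
      (i ∈ T → u i s κ * u' i s l - u' i s κ * u i s l ≠ 0) := by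
    intro i
    by_cases hi : i ∈ T
    · by_contra! hcon
      obtain ⟨k, hk⟩ : ∃ k, u i s k ≠ 0 := by
        by_contra! h0
        exact (h1 i).1 (by ext j; simpa using h0 j)
      refine (h2 i hi).1 fun j l => ?_
      have e1 := (hcon k j hk).2
      have e2 := (hcon k l hk).2
      apply mul_left_cancel₀ hk
      linear_combination u i s j * e2 - u i s l * e1
    · obtain ⟨k, hk⟩ : ∃ k, u i s k ≠ 0 := by
        by_contra! h0
        exact (h1 i).1 (by ext j; simpa using h0 j)
      exact ⟨k, k, hk, fun h => absurd h hi⟩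
  choose κ l hκ0 hl using hκ
  exact Set.mem_iUnion.2 ⟨(κ, l), s, hs, fun i => ⟨hκ0 i, (h1 i).2⟩,
    fun i hi => ⟨hl i hi, (h2 i hi).2⟩⟩

section Orbits

set_option linter.unusedSectionVars false

variable {d p : ℕ} {G : Type} [Group G] [Fintype G]
  (U : G →* (EuclideanSpace ℝ (Fin d) ≃ₗᵢ[ℝ] EuclideanSpace ℝ (Fin d)))

/-- The action of a group element as a linear map. -/
noncomputable def actLin (g : G) : Euc d →ₗ[ℝ] Euc d := (U g).toLinearEquiv

@[simp] lemma actLin_apply (g : G) (x : Euc d) : actLin U g x = U g x := rfl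

lemma act_mul (g h : G) (x : Euc d) : U (g * h) x = U g (U h x) := by
  rw [map_mul]; rfl

lemma act_one (x : Euc d) : U 1 x = x := by
  rw [map_one]; rfl

lemma act_inv_act (g : G) (x : Euc d) : U g⁻¹ (U g x) = x := by
  rw [← act_mul, inv_mul_cancel, act_one]

lemma act_act_inv (g : G) (x : Euc d) : U g (U g⁻¹ x) = x := by
  rw [← act_mul, mul_inv_cancel, act_one]

lemma act_pow_of_eigen {g : G} {c : ℝ} {x : Euc d} (h : U g x = c • x) (n : ℕ) :
    U (g ^ n) x = c ^ n • x := by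
  induction n with
  | zero => simp
  | succ n ih => rw [pow_succ, act_mul, h, map_smul, ih, smul_smul, pow_succ, mul_comm]

lemma eq_zero_of_eigen {g : G} {c : ℝ} (hc : c ^ Fintype.card G ≠ 1) {x : Euc d}
    (h : U g x = c • x) : x = 0 := by
  have h1 := act_pow_of_eigen U h (Fintype.card G)
  rw [pow_card_eq_one, act_one] at h1
  have h2 : (c ^ Fintype.card G - 1) • x = 0 := by rw [sub_smul, ← h1, one_smul, sub_self]
  exact (smul_eq_zero.1 h2).resolve_left (sub_ne_zero.2 hc)

/-- The geometric sum `∑_{j < n} c ^ (n - 1 - j) U_{g ^ j}`. -/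
noncomputable def geomAct (g : G) (c : ℝ) : ℕ → Euc d →ₗ[ℝ] Euc d
  | 0 => 0
  | n + 1 => c • geomAct g c n + actLin U (g ^ n)

lemma act_geomAct (g : G) (c : ℝ) (n : ℕ) (x : Euc d) :
    U g (geomAct U g c n x) = c • geomAct U g c n x + (U (g ^ n) x - c ^ n • x) := by
  induction n with
  | zero => simp [geomAct]
  | succ n ih =>
    simp only [geomAct, LinearMap.add_apply, LinearMap.smul_apply, actLin_apply, map_add,
      map_smul, ih]
    rw [← act_mul, ← pow_succ', pow_succ c]
    module

lemma VPoly.geomAct {σ : Type} (g : G) {c : (σ → ℝ) → ℝ} (hc : PolyFun c)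
    {v : (σ → ℝ) → Euc d} (hv : VPoly v) (n : ℕ) : VPoly fun s => geomAct U g (c s) n (v s) := by
  induction n with
  | zero => exact VPoly.const 0
  | succ n ih => exact (VPoly.smul hc ih).add (VPoly.map (actLin U (g ^ n)) hv)

/-- Parametrisation of the solutions of `U_a x - U_b y = c (U_a' x - U_b' y)`
with `y = (1 - c ^ |G|) z`. -/
noncomputable def psiX (a a' b b' : G) (c : ℝ) : Euc d →ₗ[ℝ] Euc d :=
  geomAct U (a'⁻¹ * a) c (Fintype.card G) ∘ₗ actLin U a'⁻¹ ∘ₗ (actLin U b - c • actLin U b')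

lemma psiX_rel (a a' b b' : G) (c : ℝ) (z : Euc d) :
    U a (psiX U a a' b b' c z) - U b ((1 - c ^ Fintype.card G) • z) =
      c • (U a' (psiX U a a' b b' c z) - U b' ((1 - c ^ Fintype.card G) • z)) := by
  have h := act_geomAct U (a'⁻¹ * a) c (Fintype.card G)
    (actLin U a'⁻¹ ((actLin U b - c • actLin U b') z))
  rw [pow_card_eq_one, act_one, act_mul] at h
  have h2 := congrArg (U a') h
  rw [act_act_inv] at h2
  have h3 : psiX U a a' b b' c z = geomAct U (a'⁻¹ * a) c (Fintype.card G)
    (actLin U a'⁻¹ ((actLin U b - c • actLin U b') z)) := rfl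
  rw [← h3] at h2
  rw [h2]
  simp only [map_add, map_sub, map_smul, actLin_apply, act_act_inv, LinearMap.sub_apply,
    LinearMap.smul_apply]
  module

lemma psiX_surj (a a' b b' : G) {c : ℝ} (hc : c ^ Fintype.card G ≠ 1) {x y : Euc d}
    (h : U a x - U b y = c • (U a' x - U b' y)) :
    x = psiX U a a' b b' c ((1 - c ^ Fintype.card G)⁻¹ • y) := by
  have h1 := psiX_rel U a a' b b' c ((1 - c ^ Fintype.card G)⁻¹ • y)
  rw [smul_smul, mul_inv_cancel₀ (sub_ne_zero.2 hc.symm), one_smul] at h1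
  generalize psiX U a a' b b' c ((1 - c ^ Fintype.card G)⁻¹ • y) = x' at h1 ⊢
  rw [← sub_eq_zero]
  refine eq_zero_of_eigen U (g := a'⁻¹ * a) hc ?_
  rw [act_mul]
  apply (U a').injective
  rw [act_act_inv, map_smul, map_sub, map_sub]
  have h2 : ∀ e₁ e₂ e₃ e₄ e₅ e₆ : Euc d, e₁ - e₂ = c • (e₃ - e₄) → e₅ - e₂ = c • (e₆ - e₄) →
      e₁ - e₅ = c • (e₃ - e₆) := by
    intro e₁ e₂ e₃ e₄ e₅ e₆ h h'
    have h3 : e₁ - e₅ = (e₁ - e₂) - (e₅ - e₂) := by abel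
    rw [h3, h, h']
    module
  exact h2 _ _ _ _ _ _ h h1

lemma VPoly.psiX {σ : Type} (a a' b b' : G) {c : (σ → ℝ) → ℝ} (hc : PolyFun c)
    {z : (σ → ℝ) → Euc d} (hz : VPoly z) : VPoly fun s => psiX U a a' b b' (c s) (z s) := by
  have h1 : VPoly fun s => (actLin U b - c s • actLin U b') (z s) :=
    (VPoly.map (actLin U b) hz).sub (VPoly.smul hc (VPoly.map (actLin U b') hz))
  exact VPoly.geomAct U _ hc (VPoly.map (actLin U a'⁻¹) h1) _

variable {Q : Type} [Finite Q] (col : Q → Fin p) (α β : Q → G)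

/-- The difference vector `U_{α q} x - U_{β q} y`. -/
noncomputable def diffVec (q : Q) : Euc d → Euc d → Euc d := fun x y => U (α q) x - U (β q) y

lemma diffVec_smul (q : Q) (c : ℝ) (x y : Euc d) :
    diffVec U α β q (c • x) (c • y) = c • diffVec U α β q x y := by
  simp [diffVec, smul_sub]

lemma diffVec_add (q : Q) (x x' y y' : Euc d) :
    diffVec U α β q (x + x') (y + y') = diffVec U α β q x y + diffVec U α β q x' y' := by
  simp only [diffVec, map_add]; abel

lemma VPoly.diffVec {σ : Type} {x y : (σ → ℝ) → Euc d} (hx : VPoly x) (hy : VPoly y) (q : Q) :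
    VPoly fun s => diffVec U α β q (x s) (y s) :=
  (VPoly.map (actLin U (α q)) hx).sub (VPoly.map (actLin U (β q)) hy)

/-- All difference vectors are nonzero and orthogonal to the corresponding window. -/
def Bad (w : Fin p → Euc d) (x y : Euc d) : Prop :=
  ∀ q, diffVec U α β q x y ≠ 0 ∧ ⟪w (col q), diffVec U α β q x y⟫ = 0

variable {U col α β}

lemma Bad.smul {w : Fin p → Euc d} {x y : Euc d} (h : Bad U col α β w x y) {c : ℝ}
    (hc : c ≠ 0) : Bad U col α β w (c • x) (c • y) := by
  intro q
  rw [diffVec_smul]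
  exact ⟨smul_ne_zero hc (h q).1, by rw [inner_smul_right, (h q).2, mul_zero]⟩

lemma Par.smul {u v : Euc d} (c : ℝ) (h : Par u v) : Par (c • u) (c • v) := by
  intro j l
  have := h j l
  simp only [PiLp.smul_apply, smul_eq_mul]
  linear_combination c ^ 2 * this

lemma Par.of_smul {u v : Euc d} {c : ℝ} (hc : c ≠ 0) (h : Par (c • u) (c • v)) : Par u v := by
  have := h.smul c⁻¹
  rwa [smul_smul, smul_smul, inv_mul_cancel₀ hc, one_smul, one_smul] at this

lemma Par.exists_smul {u v : Euc d} (h : Par u v) (hu : u ≠ 0) : ∃ c : ℝ, v = c • u := by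
  obtain ⟨k, hk⟩ : ∃ k, u k ≠ 0 := by
    by_contra! h0
    exact hu (by ext j; simpa using h0 j)
  refine ⟨v k / u k, ?_⟩
  ext j
  have := h j k
  simp only [PiLp.smul_apply, smul_eq_mul]
  field_simp
  linarith

lemma Par.symm {u v : Euc d} (h : Par u v) : Par v u := fun j l => by linarith [h l j]

lemma exists_normalise {σ : Type} [Fintype σ] {s : σ → ℝ} (hs : s ≠ 0) :
    ∃ c : ℝ, c ≠ 0 ∧ ∑ k, (c • s) k ^ 2 - 1 = 0 := by
  have hpos : 0 < ∑ k, s k ^ 2 := by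
    obtain ⟨k, hk⟩ := Function.ne_iff.1 hs
    exact Finset.sum_pos' (fun _ _ => sq_nonneg _) ⟨k, Finset.mem_univ k, by
      have : s k ≠ 0 := hk
      positivity⟩
  refine ⟨(√(∑ k, s k ^ 2))⁻¹, by positivity, ?_⟩
  simp only [Pi.smul_apply, smul_eq_mul, mul_pow, ← Finset.mul_sum, inv_pow]
  rw [Real.sq_sqrt hpos.le, inv_mul_cancel₀ hpos.ne', sub_self]

/-- Some column in which two difference vectors are independent. -/
def NonParCol {Q : Type} (U : G →* (EuclideanSpace ℝ (Fin d) ≃ₗᵢ[ℝ] EuclideanSpace ℝ (Fin d)))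
    (col : Q → Fin p) (α β : Q → G) (i : Fin p) (x y : Euc d) : Prop :=
  ∃ q q', col q = i ∧ col q' = i ∧ ¬ Par (diffVec U α β q x y) (diffVec U α β q' x y)

lemma NonParCol.smul {i : Fin p} {x y : Euc d} (h : NonParCol U col α β i x y) {c : ℝ}
    (hc : c ≠ 0) : NonParCol U col α β i (c • x) (c • y) := by
  obtain ⟨q, q', h1, h2, h3⟩ := h
  refine ⟨q, q', h1, h2, fun h => h3 ?_⟩
  rw [diffVec_smul, diffVec_smul] at h
  exact h.of_smul hc

lemma polySmall_of_param {σ : Type} [Fintype σ] (hcol : Function.Surjective col)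
    (T : Finset (Fin p)) (hcard : Fintype.card σ ≤ p + T.card)
    {h : (σ → ℝ) → ℝ} (hh : PolyFun h) (hne : ∃ s, h s ≠ 0) {x y : (σ → ℝ) → Euc d}
    (hx : VPoly x) (hy : VPoly y) :
    PolySmall {w : Fin p → Euc d | ∃ s, h s = 0 ∧ Bad U col α β w (x s) (y s) ∧
      ∀ i ∈ T, NonParCol U col α β i (x s) (y s)} := by
  classical
  have hfix : ∀ e : (Fin p → Q) × (Fin p → Q),
      PolySmall {w : Fin p → Euc d | ∃ s, h s = 0 ∧
        (∀ i, diffVec U α β (e.1 i) (x s) (y s) ≠ 0 ∧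
          ⟪w i, diffVec U α β (e.1 i) (x s) (y s)⟫ = 0) ∧
        ∀ i ∈ T, ¬ Par (diffVec U α β (e.1 i) (x s) (y s))
          (diffVec U α β (e.2 i) (x s) (y s)) ∧
          ⟪w i, diffVec U α β (e.2 i) (x s) (y s)⟫ = 0} := fun e =>
    incidence T hcard hh hne (u := fun i s => diffVec U α β (e.1 i) (x s) (y s))
      (u' := fun i s => diffVec U α β (e.2 i) (x s) (y s))
      (fun i => VPoly.diffVec U α β hx hy _) (fun i => VPoly.diffVec U α β hx hy _)
  refine (PolySmall.iUnion hfix).mono ?_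
  rintro w ⟨s, hs, hbad, hT⟩
  have hch : ∀ i, ∃ q q', col q = i ∧ col q' = i ∧ (i ∈ T →
      ¬ Par (diffVec U α β q (x s) (y s)) (diffVec U α β q' (x s) (y s))) := by
    intro i
    by_cases hi : i ∈ T
    · obtain ⟨q, q', h1, h2, h3⟩ := hT i hi
      exact ⟨q, q', h1, h2, fun _ => h3⟩
    · obtain ⟨q, hq⟩ := hcol i
      exact ⟨q, q, hq, hq, fun h => absurd h hi⟩
  choose e e' he he' hpar using hch
  refine Set.mem_iUnion.2 ⟨(e, e'), s, hs, fun i => ?_, fun i hi => ⟨hpar i hi, ?_⟩⟩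
  · have := hbad (e i)
    rwa [he i] at this
  · have := (hbad (e' i)).2
    rwa [he' i] at this

lemma VPoly.linear {σ : Type} [Fintype σ] (X : (σ → ℝ) →ₗ[ℝ] Euc d) : VPoly fun s => X s := by
  classical
  have h : (fun s => X s) = fun s => ∑ i, s i • X (Pi.single i 1) := by
    funext s
    rw [LinearMap.pi_apply_eq_sum_univ]
    refine Finset.sum_congr rfl fun i _ => ?_
    congr 2
    funext j
    simp [Pi.single_apply, eq_comm]
  rw [h]
  exact VPoly.sum _ fun i _ => VPoly.smul (PolyFun.coord i) (VPoly.const _)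

lemma polySmall_of_linear {σ : Type} [Fintype σ] [Nonempty Q] (hcol : Function.Surjective col)
    (T : Finset (Fin p)) (hcard : Fintype.card σ ≤ p + T.card) (X Y : (σ → ℝ) →ₗ[ℝ] Euc d) :
    PolySmall {w : Fin p → Euc d | ∃ s, Bad U col α β w (X s) (Y s) ∧
      ∀ i ∈ T, NonParCol U col α β i (X s) (Y s)} := by
  refine (polySmall_of_param (U := U) (α := α) (β := β) hcol T hcard
    (h := fun s => ∑ k, s k ^ 2 - 1) ((PolyFun.sum _ fun k _ => (PolyFun.coord k).pow 2).sub
      (PolyFun.const 1)) ⟨0, by simp⟩ (VPoly.linear X) (VPoly.linear Y)).mono ?_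
  rintro w ⟨s, hbad, hT⟩
  have hs : s ≠ 0 := by
    rintro rfl
    obtain ⟨q⟩ := ‹Nonempty Q›
    exact (hbad q).1 (by simp [diffVec])
  obtain ⟨c, hc, hc1⟩ := exists_normalise hs
  refine ⟨c • s, hc1, ?_, fun i hi => ?_⟩
  · rw [map_smul, map_smul]; exact hbad.smul hc
  · rw [map_smul, map_smul]; exact (hT i hi).smul hc

lemma polySmall_of_submodule [Nonempty Q] (hcol : Function.Surjective col)
    (T : Finset (Fin p)) (K : Submodule ℝ (Euc d × Euc d))
    (hK : Module.finrank ℝ K ≤ p + T.card) :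
    PolySmall {w : Fin p → Euc d | ∃ x y, (x, y) ∈ K ∧ Bad U col α β w x y ∧
      ∀ i ∈ T, NonParCol U col α β i x y} := by
  let b := (Module.finBasis ℝ K).equivFun
  let X : (Fin (Module.finrank ℝ K) → ℝ) →ₗ[ℝ] Euc d × Euc d := K.subtype ∘ₗ b.symm.toLinearMap
  refine (polySmall_of_linear (U := U) (α := α) (β := β) hcol T (by simpa using hK)
    (LinearMap.fst ℝ _ _ ∘ₗ X) (LinearMap.snd ℝ _ _ ∘ₗ X)).mono ?_
  rintro w ⟨x, y, hxy, h⟩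
  refine ⟨b ⟨(x, y), hxy⟩, ?_⟩
  simpa [X] using h

lemma polySmall_all_nonPar [Nonempty Q] (hcol : Function.Surjective col)
    (T : Finset (Fin p)) (hT : 2 * d ≤ p + T.card) :
    PolySmall {w : Fin p → Euc d | ∃ x y, Bad U col α β w x y ∧
      ∀ i ∈ T, NonParCol U col α β i x y} := by
  refine (polySmall_of_submodule (U := U) (α := α) (β := β) hcol T ⊤ ?_).mono ?_
  · rw [finrank_top, Module.finrank_prod, finrank_euclideanSpace_fin]
    omega
  · rintro w ⟨x, y, h⟩
    exact ⟨x, y, trivial, h⟩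

lemma rankMin_le_finrank_range (g : G) (c : ℝ) :
    rankMin U g ≤ Module.finrank ℝ (LinearMap.range (actLin U g - c • LinearMap.id)) :=
  Nat.sInf_le ⟨c, rfl⟩

/-- The ratio `c` is fixed. -/
lemma polySmall_fixed_ratio [Nonempty Q] (hcol : Function.Surjective col) (hp : p ≤ 2 * d)
    {q q' : Q} (hr : 2 * d - p ≤ rankMin U ((α q')⁻¹ * α q)) (c : ℝ) :
    PolySmall {w : Fin p → Euc d | ∃ x y, Bad U col α β w x y ∧
      diffVec U α β q x y = c • diffVec U α β q' x y} := by
  let f : Euc d →ₗ[ℝ] Euc d := actLin U (α q) - c • actLin U (α q')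
  let f' : Euc d →ₗ[ℝ] Euc d := actLin U (β q) - c • actLin U (β q')
  let K : Submodule ℝ (Euc d × Euc d) := LinearMap.eqLocus
    (f ∘ₗ LinearMap.fst ℝ _ _) (f' ∘ₗ LinearMap.snd ℝ _ _)
  have hf : 2 * d - p ≤ Module.finrank ℝ (LinearMap.range f) := by
    refine (hr.trans (rankMin_le_finrank_range _ c)).trans ?_
    have hcomp : actLin U ((α q')⁻¹ * α q) - c • LinearMap.id = actLin U (α q')⁻¹ ∘ₗ f := by
      ext1 x
      simp [f]
    rw [hcomp, LinearMap.range_comp]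
    exact Submodule.finrank_map_le _ _
  have hK : Module.finrank ℝ K ≤ p := by
    let π : K →ₗ[ℝ] Euc d := LinearMap.snd ℝ _ _ ∘ₗ K.subtype
    have h1 := LinearMap.finrank_range_add_finrank_ker π
    have h2 : Module.finrank ℝ (LinearMap.range π) ≤ d := by
      simpa using Submodule.finrank_le (LinearMap.range π)
    have h3 := LinearMap.finrank_range_add_finrank_ker f
    rw [finrank_euclideanSpace_fin] at h3
    have h4 : Module.finrank ℝ (LinearMap.ker π) ≤ Module.finrank ℝ (LinearMap.ker f) := by
      let j : LinearMap.ker π →ₗ[ℝ] LinearMap.ker f :=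
        LinearMap.codRestrict _ (LinearMap.fst ℝ _ _ ∘ₗ K.subtype ∘ₗ Submodule.subtype _) (by
          rintro ⟨⟨⟨x, y⟩, hxy⟩, hy⟩
          have hy' : y = 0 := hy
          have hxy' : f x = f' y := hxy
          simpa [hy'] using hxy')
      refine LinearMap.finrank_le_finrank_of_injective (f := j) ?_
      rintro ⟨⟨⟨x, y⟩, hxy⟩, hy⟩ ⟨⟨⟨x', y'⟩, hxy'⟩, hy'⟩ h
      have e1 : y = 0 := hy
      have e2 : y' = 0 := hy'
      have e3 : x = x' := congrArg Subtype.val h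
      simp [e1, e2, e3]
    omega
  refine (polySmall_of_submodule (U := U) (α := α) (β := β) hcol ∅ K (by simpa using hK)).mono ?_
  rintro w ⟨x, y, hbad, h⟩
  refine ⟨x, y, ?_, hbad, by simp⟩
  change f x = f' y
  simp only [diffVec, smul_sub] at h
  simp only [f, f', LinearMap.sub_apply, LinearMap.smul_apply, actLin_apply]
  rw [sub_eq_sub_iff_add_eq_add] at h ⊢
  rw [h, add_comm]

/-- The ratio `c` varies with `c ^ |G| ≠ 1`, with enough constraints available. -/
lemma polySmall_moving_ratio [Nonempty Q] (hcol : Function.Surjective col) (T : Finset (Fin p))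
    (hT : d + 1 ≤ p + T.card) (q q' : Q) :
    PolySmall {w : Fin p → Euc d | ∃ x y, Bad U col α β w x y ∧
      (∃ c : ℝ, c ^ Fintype.card G ≠ 1 ∧
        diffVec U α β q x y = c • diffVec U α β q' x y) ∧
      ∀ i ∈ T, NonParCol U col α β i x y} := by
  have hz : VPoly fun s : Fin d ⊕ Unit → ℝ => (WithLp.toLp 2 fun j => s (Sum.inl j) : Euc d) :=
    VPoly.toLp fun j => PolyFun.coord (Sum.inl j)
  have hc : PolyFun fun s : Fin d ⊕ Unit → ℝ => s (Sum.inr ()) := PolyFun.coord _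
  refine (polySmall_of_param (U := U) (α := α) (β := β) (σ := Fin d ⊕ Unit) hcol T
    (by simpa using hT) (h := fun s => ∑ k, s (Sum.inl k) ^ 2 - 1)
    ((PolyFun.sum _ fun k _ => (PolyFun.coord (Sum.inl k)).pow 2).sub
      (PolyFun.const 1)) ⟨0, by simp⟩ (VPoly.psiX U (α q) (α q') (β q) (β q') hc hz)
      (VPoly.smul ((PolyFun.const 1).sub (hc.pow (Fintype.card G))) hz)).mono ?_
  rintro w ⟨x, y, hbad, ⟨c, hc, hq⟩, hT⟩
  have hx := psiX_surj U (α q) (α q') (β q) (β q') hc hq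
  set z : Euc d := (1 - c ^ Fintype.card G)⁻¹ • y with hzdef
  have hy : y = (1 - c ^ Fintype.card G) • z := by
    rw [hzdef, smul_smul, mul_inv_cancel₀ (sub_ne_zero.2 hc.symm), one_smul]
  have hz0 : (fun j => z j) ≠ 0 := by
    intro h0
    have hz0 : z = 0 := by ext j; exact congrFun h0 j
    rw [hz0, map_zero] at hx
    rw [hz0, smul_zero] at hy
    exact (hbad q).1 (by simp [diffVec, hx, hy])
  obtain ⟨t, ht, ht1⟩ := exists_normalise hz0
  refine ⟨Sum.elim (fun j => t * z j) fun _ => c, ht1, ?_⟩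
  have e1 : (WithLp.toLp 2 fun j => t * z j : Euc d) = t • z := rfl
  simp only [Sum.elim_inl, Sum.elim_inr, e1, map_smul, smul_comm _ t z, ← hx, ← hy]
  exact ⟨hbad.smul ht, fun i hi => (hT i hi).smul ht⟩

lemma Par.zero_left (v : Euc d) : Par 0 v := by
  intro j l
  simp

lemma Par.self (v : Euc d) : Par v v := fun _ _ => mul_comm _ _

lemma exists_coord_ne_zero {u : Euc d} (hu : u ≠ 0) : ∃ k, u k ≠ 0 := by
  by_contra! h0
  exact hu (by ext j; simpa using h0 j)

/-- A vector parallel to two independent vectors vanishes. -/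
lemma eq_zero_of_par_of_par {u v x : Euc d} (huv : ¬ Par u v) (hu : Par u x) (hv : Par v x) :
    x = 0 := by
  by_contra hx
  obtain ⟨a, rfl⟩ := hu.symm.exists_smul hx
  obtain ⟨b, rfl⟩ := hv.symm.exists_smul hx
  refine huv fun j l => ?_
  simp only [PiLp.smul_apply, smul_eq_mul]
  ring

/-- Two linear maps with pointwise parallel values are proportional, unless the first one has
rank at most one. -/
lemma exists_smul_of_forall_par {f f' : Euc d →ₗ[ℝ] Euc d} (h : ∀ z, Par (f z) (f' z))
    {z₁ z₂ : Euc d} (h12 : ¬ Par (f z₁) (f z₂)) : ∃ c : ℝ, f' = c • f := by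
  have h1 : f z₁ ≠ 0 := fun h0 => h12 (h0 ▸ Par.zero_left _)
  obtain ⟨c, hc⟩ := (h z₁).exists_smul h1
  refine ⟨c, ?_⟩
  have hg : ∀ z, Par (f z) (f' z - c • f z) := by
    intro z j l
    have := h z j l
    simp only [PiLp.sub_apply, PiLp.smul_apply, smul_eq_mul]
    linear_combination this
  have hpol : ∀ a, f' a = c • f a → ∀ z, Par (f a) (f' z - c • f z) := by
    intro a ha z j l
    have e1 := hg (z + a) j l
    have e2 := hg z j l
    simp only [map_add, ha, PiLp.add_apply, PiLp.sub_apply, PiLp.smul_apply, smul_eq_mul]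
      at e1 e2 ⊢
    linear_combination e1 - e2
  have h2 : f' z₂ = c • f z₂ := by
    rw [← sub_eq_zero]
    exact eq_zero_of_par_of_par h12 (hpol z₁ hc z₂) (hg z₂)
  ext1 z
  rw [LinearMap.smul_apply, ← sub_eq_zero]
  exact eq_zero_of_par_of_par h12 (hpol z₁ hc z) (hpol z₂ h2 z)

/-- No real eigenvalue. -/
def NoEig (U : G →* (EuclideanSpace ℝ (Fin d) ≃ₗᵢ[ℝ] EuclideanSpace ℝ (Fin d))) (g : G) : Prop :=
  ∀ (c : ℝ) (x : Euc d), U g x = c • x → x = 0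

lemma rankMin_lt_of_eigen {g : G} {c : ℝ} {x : Euc d} (hx : x ≠ 0) (h : U g x = c • x) :
    rankMin U g < d := by
  refine (rankMin_le_finrank_range (U := U) g c).trans_lt ?_
  have h1 := LinearMap.finrank_range_add_finrank_ker (actLin U g - c • LinearMap.id)
  rw [finrank_euclideanSpace_fin] at h1
  have h2 : 0 < Module.finrank ℝ (LinearMap.ker (actLin U g - c • LinearMap.id)) := by
    rw [Module.finrank_pos_iff_exists_ne_zero]
    refine ⟨⟨x, ?_⟩, fun h0 => hx (congrArg Subtype.val h0)⟩
    simp [h]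
  omega

lemma noEig_of_le_rankMin {g : G} (h : d ≤ rankMin U g) : NoEig U g := by
  intro c x hx
  by_contra h0
  exact absurd (rankMin_lt_of_eigen h0 hx) (not_lt.2 h)

lemma NoEig.eq_zero {a a' : G} (h : NoEig U (a'⁻¹ * a)) {c : ℝ} {x : Euc d}
    (hx : U a' x = c • U a x) : x = 0 := by
  rcases eq_or_ne c 0 with rfl | hc
  · rw [zero_smul] at hx
    exact (U a').injective (by rw [hx, map_zero])
  · refine h c⁻¹ x ?_
    rw [act_mul]
    apply (U a').injective
    rw [act_act_inv, map_smul, hx, smul_smul, inv_mul_cancel₀ hc, one_smul]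

/-- A family of linear maps depending polynomially on a real parameter. -/
def PolyLin (f : ℝ → Euc d →ₗ[ℝ] Euc d) : Prop :=
  ∀ {σ : Type} {c : (σ → ℝ) → ℝ} {z : (σ → ℝ) → Euc d}, PolyFun c → VPoly z →
    VPoly fun s => f (c s) (z s)

lemma PolyFun.minor {σ : Type} {u v : (σ → ℝ) → Euc d} (hu : VPoly u) (hv : VPoly v)
    (j l : Fin d) : PolyFun fun s => u s j * v s l - u s l * v s j :=
  ((hu j).mul (hv l)).sub ((hu l).mul (hv j))

lemma VPoly.update {σ : Type} [DecidableEq σ] {v : Fin d → σ} (k : σ) (b : ℝ) :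
    VPoly fun s : σ → ℝ => (WithLp.toLp 2 fun j => Function.update s k b (v j) : Euc d) := by
  refine VPoly.toLp fun j => ?_
  by_cases h : v j = k
  · simpa [h] using PolyFun.const b
  · simpa [Function.update_of_ne h] using PolyFun.coord (v j)

lemma polySmall_of_minor [Nonempty Q] (hcol : Function.Surjective col) (hp : d ≤ p)
    {X Y : ℝ → Euc d →ₗ[ℝ] Euc d} (hX : PolyLin X) (hY : PolyLin Y)
    {q q' : Q} (hqq : col q = col q')
    (hne : ∃ z c, ¬ Par (diffVec U α β q (X c z) (Y c z)) (diffVec U α β q' (X c z) (Y c z))) :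
    PolySmall {w : Fin p → Euc d | ∃ z c, Bad U col α β w (X c z) (Y c z) ∧
      ∀ i, ¬ NonParCol U col α β i (X c z) (Y c z)} := by
  classical
  obtain ⟨z₀, c₀, hne⟩ := hne
  simp only [Par, not_forall] at hne
  obtain ⟨j, l, hjl⟩ := hne
  let m : Euc d → ℝ → ℝ := fun z c =>
    diffVec U α β q (X c z) (Y c z) j * diffVec U α β q' (X c z) (Y c z) l -
      diffVec U α β q (X c z) (Y c z) l * diffVec U α β q' (X c z) (Y c z) j
  have hm : ∀ {σ : Type} {c : (σ → ℝ) → ℝ} {z : (σ → ℝ) → Euc d}, PolyFun c → VPoly z →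
      PolyFun fun s => m (z s) (c s) := fun hc hz =>
    PolyFun.minor (VPoly.diffVec U α β (hX hc hz) (hY hc hz) q)
      (VPoly.diffVec U α β (hX hc hz) (hY hc hz) q') j l
  have hmsmul : ∀ t z c, m (t • z) c = t ^ 2 * m z c := by
    intro t z c
    simp only [m, map_smul, diffVec_smul, PiLp.smul_apply, smul_eq_mul]
    ring
  have hm0 : m z₀ c₀ ≠ 0 := sub_ne_zero.2 hjl
  have hk : ∀ k : Fin d, ∃ s : Fin d → ℝ,
      m (WithLp.toLp 2 (fun j => Function.update s k 1 j)) (s k) ≠ 0 := by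
    intro k
    by_contra! h0
    have hz : VPoly fun s : Fin d ⊕ Unit → ℝ => (WithLp.toLp 2 fun j => s (Sum.inl j) : Euc d) :=
      VPoly.toLp fun j => PolyFun.coord (Sum.inl j)
    have hc : PolyFun fun s : Fin d ⊕ Unit → ℝ => s (Sum.inr ()) := PolyFun.coord _
    refine hm0 (PolyFun.eq_zero_of_mul_eq_zero (PolyFun.coord (Sum.inl k)) (hm hc hz) ?_
      ⟨fun _ => 1, one_ne_zero⟩ (Sum.elim (fun j => z₀ j) fun _ => c₀))
    intro s
    rcases eq_or_ne (s (Sum.inl k)) 0 with h1 | h1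
    · rw [h1, zero_mul]
    · have h2 := h0 (Function.update (fun j => (s (Sum.inl k))⁻¹ * s (Sum.inl j)) k
        (s (Sum.inr ())))
      rw [Function.update_self, Function.update_idem] at h2
      have h3 : (WithLp.toLp 2 (fun j' => Function.update
          (fun j => (s (Sum.inl k))⁻¹ * s (Sum.inl j)) k 1 j') : Euc d) =
          (s (Sum.inl k))⁻¹ • WithLp.toLp 2 fun j => s (Sum.inl j) := by
        ext j'
        by_cases hj : j' = k
        · subst hj; simp [h1]
        · simp [hj]
      rw [h3, hmsmul] at h2
      rw [(mul_eq_zero.1 h2).resolve_left (by positivity), mul_zero]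
  have hfam := fun k : Fin d => polySmall_of_param (U := U) (α := α) (β := β) (σ := Fin d)
    hcol ∅ (by simpa using hp) (hm (PolyFun.coord k) (VPoly.update (v := id) k 1)) (hk k)
    (hX (PolyFun.coord k) (VPoly.update (v := id) k 1))
    (hY (PolyFun.coord k) (VPoly.update (v := id) k 1))
  refine (PolySmall.iUnion hfam).mono ?_
  rintro w ⟨z, c, hbad, hpar⟩
  have hz : z ≠ 0 := by
    rintro rfl
    obtain ⟨q⟩ := ‹Nonempty Q›
    exact (hbad q).1 (by simp [diffVec])
  obtain ⟨k, hk⟩ := exists_coord_ne_zero hz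
  have hz' : (WithLp.toLp 2 (fun j' => Function.update
      (Function.update (fun j => (z k)⁻¹ * z j) k c) k 1 j') : Euc d) = (z k)⁻¹ • z := by
    ext j'
    by_cases hj : j' = k
    · subst hj; simp [hk]
    · simp [hj]
  refine Set.mem_iUnion.2 ⟨k, Function.update (fun j => (z k)⁻¹ * z j) k c, ?_, ?_, by simp⟩
  · simp only [id, hz', Function.update_self, hmsmul]
    have : Par (diffVec U α β q (X c z) (Y c z)) (diffVec U α β q' (X c z) (Y c z)) := by
      by_contra h
      exact hpar (col q) ⟨q, q', rfl, hqq.symm, h⟩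
    rw [show m z c = 0 from sub_eq_zero.2 (this j l), mul_zero]
  · simp only [id, hz', Function.update_self, map_smul]
    exact hbad.smul (inv_ne_zero hk)

variable (U α β) in
/-- The difference vectors along the parametrisation `psiX` with base pair `r, r'`. -/
noncomputable def psiVec (r r' q : Q) (c : ℝ) (z : Euc d) : Euc d :=
  diffVec U α β q (psiX U (α r) (α r') (β r) (β r') c z) ((1 - c ^ Fintype.card G) • z)

lemma psiVec_add (r r' q : Q) (c : ℝ) (z z' : Euc d) :
    psiVec U α β r r' q c (z + z') = psiVec U α β r r' q c z + psiVec U α β r r' q c z' := by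
  simp only [psiVec, map_add, smul_add, diffVec_add]

lemma psiVec_smul (r r' q : Q) (c t : ℝ) (z : Euc d) :
    psiVec U α β r r' q c (t • z) = t • psiVec U α β r r' q c z := by
  simp only [psiVec, map_smul, smul_comm _ t z, diffVec_smul]

lemma psiVec_rel (r r' : Q) (c : ℝ) (z : Euc d) :
    psiVec U α β r r' r c z = c • psiVec U α β r r' r' c z :=
  psiX_rel U (α r) (α r') (β r) (β r') c z

lemma psiVec_surj {r r' : Q} {c : ℝ} (hc : c ^ Fintype.card G ≠ 1) {x y : Euc d}
    (h : diffVec U α β r x y = c • diffVec U α β r' x y) (q : Q) :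
    psiVec U α β r r' q c ((1 - c ^ Fintype.card G)⁻¹ • y) = diffVec U α β q x y := by
  rw [psiVec, ← psiX_surj U _ _ _ _ hc h, smul_smul, mul_inv_cancel₀ (sub_ne_zero.2 hc.symm),
    one_smul]

lemma polyLin_psiX (a a' b b' : G) : PolyLin (psiX U a a' b b') :=
  fun hc hz => VPoly.psiX U a a' b b' hc hz

lemma polyLin_psiY : PolyLin fun c => (1 - c ^ Fintype.card G) • (LinearMap.id : Euc d →ₗ[ℝ] _) :=
  fun hc hz => VPoly.smul ((PolyFun.const 1).sub (hc.pow _)) hz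

lemma VPoly.psiVec {σ : Type} (r r' q : Q) {c : (σ → ℝ) → ℝ} {z : (σ → ℝ) → Euc d}
    (hc : PolyFun c) (hz : VPoly z) : VPoly fun s => psiVec U α β r r' q (c s) (z s) :=
  VPoly.diffVec U α β (polyLin_psiX _ _ _ _ hc hz) (polyLin_psiY hc hz) q

/-- Along a direction `(x₁, z₁)` on which the base difference vectors vanish, `psiVec` moves
by a multiple of a constant vector. -/
lemma psiVec_kernel {r r' : Q} {x₁ z₁ : Euc d} (h : diffVec U α β r x₁ z₁ = 0)
    (h' : diffVec U α β r' x₁ z₁ = 0) (q : Q) {c : ℝ} (hc : c ^ Fintype.card G ≠ 1) :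
    psiVec U α β r r' q c z₁ = (1 - c ^ Fintype.card G) • diffVec U α β q x₁ z₁ := by
  rw [← psiVec_surj (r := r) (r' := r') hc (by rw [h, h', smul_zero]) q, ← psiVec_smul, smul_smul,
    mul_inv_cancel₀ (sub_ne_zero.2 hc.symm), one_smul]

variable [Nonempty Q]

/-- The constant vector of a kernel direction is parallel to `psiVec`. -/
lemma par_kernel_psiVec {r r' : Q}
    (hR : ∀ q q', col q = col q' → ∀ c z, Par (psiVec U α β r r' q c z) (psiVec U α β r r' q' c z))
    {x₁ z₁ : Euc d} (h : diffVec U α β r x₁ z₁ = 0) (h' : diffVec U α β r' x₁ z₁ = 0)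
    (hne : ∃ c z, c ^ Fintype.card G ≠ 1 ∧ psiVec U α β r r' r' c z ≠ 0)
    {q q' : Q} (hqq : col q = col q') (hq : NoEig U ((α q')⁻¹ * α q))
    {c : ℝ} (hc : c ^ Fintype.card G ≠ 1) (z : Euc d) :
    Par (diffVec U α β q x₁ z₁) (psiVec U α β r r' q c z) := by
  by_contra hnot
  have hN : Fintype.card G ≠ 0 := Fintype.card_ne_zero
  set v := diffVec U α β q x₁ z₁ with hv
  have hv0 : v ≠ 0 := fun h0 => hnot (h0 ▸ Par.zero_left _)
  have h00 : (0 : ℝ) ^ Fintype.card G ≠ 1 := by simp [hN]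
  obtain ⟨lam, hlam⟩ : ∃ lam : ℝ, diffVec U α β q' x₁ z₁ = lam • v := by
    have h1 := hR q q' hqq 0 z₁
    rw [psiVec_kernel h h' q h00, psiVec_kernel h h' q' h00] at h1
    exact (h1.of_smul (sub_ne_zero.2 h00.symm)).exists_smul hv0
  -- the linear variation of the parallelism relation
  have hlin : ∀ b y, b ^ Fintype.card G ≠ 1 → ¬ Par v (psiVec U α β r r' q b y) →
      psiVec U α β r r' q' b y = lam • psiVec U α β r r' q b y := by
    intro b y hb hpar
    have hb1 := sub_ne_zero.2 hb.symm
    have e0 := hR q q' hqq b y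
    have e1 := hR q q' hqq b (y + (1 - b ^ Fintype.card G)⁻¹ • z₁)
    simp only [psiVec_add, psiVec_smul] at e1
    rw [psiVec_kernel h h' q hb, psiVec_kernel h h' q' hb, hlam, smul_smul,
      smul_smul, inv_mul_cancel₀ hb1, one_smul, one_smul] at e1
    rw [← sub_eq_zero]
    refine eq_zero_of_par_of_par hpar (fun j l => ?_) (fun j l => ?_)
    · have f0 := e0 j l
      have f1 := e1 j l
      simp only [PiLp.add_apply, PiLp.sub_apply, PiLp.smul_apply, smul_eq_mul] at f1 ⊢
      linear_combination f1 - f0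
    · have f0 := e0 j l
      simp only [PiLp.sub_apply, PiLp.smul_apply, smul_eq_mul]
      linear_combination f0
  have hall : ∀ b y, psiVec U α β r r' q' b y = lam • psiVec U α β r r' q b y := by
    intro b y
    ext k
    simp only [Par, not_forall] at hnot
    obtain ⟨j, l, hjl⟩ := hnot
    have hz : VPoly fun s : Fin d ⊕ Unit → ℝ => (WithLp.toLp 2 fun j => s (Sum.inl j) : Euc d) :=
      VPoly.toLp fun j => PolyFun.coord (Sum.inl j)
    have hb : PolyFun fun s : Fin d ⊕ Unit → ℝ => s (Sum.inr ()) := PolyFun.coord _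
    have hpq := VPoly.psiVec (U := U) (α := α) (β := β) r r' q hb hz
    have hpq' := VPoly.psiVec (U := U) (α := α) (β := β) r r' q' hb hz
    have key := PolyFun.eq_zero_of_mul_eq_zero
      (((PolyFun.const 1).sub (hb.pow (Fintype.card G))).mul
        (PolyFun.minor (VPoly.const v) hpq j l))
      ((hpq' k).sub ((PolyFun.const lam).mul (hpq k))) ?_
      ⟨Sum.elim (fun j => z j) fun _ => c,
        mul_ne_zero (sub_ne_zero.2 hc.symm) (sub_ne_zero.2 hjl)⟩
      (Sum.elim (fun j => y j) fun _ => b)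
    · exact sub_eq_zero.1 key
    · intro s
      by_cases h1 : s (Sum.inr ()) ^ Fintype.card G = 1
      · simp [h1]
      · by_cases h2 : Par v (psiVec U α β r r' q (s (Sum.inr ()))
            (WithLp.toLp 2 fun j => s (Sum.inl j)))
        · rw [sub_eq_zero.2 (h2 j l)]; ring
        · beta_reduce
          rw [hlin _ _ h1 h2]; simp
  have hinj : ∀ x x' y : Euc d, diffVec U α β q' x y = lam • diffVec U α β q x y →
      diffVec U α β q' x' y = lam • diffVec U α β q x' y → x = x' := by
    intro x x' y e e'
    rw [← sub_eq_zero]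
    refine NoEig.eq_zero hq (c := lam) ?_
    simp only [diffVec] at e e'
    rw [map_sub, map_sub]
    have : ∀ e₁ e₂ e₃ e₄ e₅ e₆ : Euc d, e₁ - e₂ = lam • (e₃ - e₄) → e₅ - e₂ = lam • (e₆ - e₄) →
        e₁ - e₅ = lam • (e₃ - e₆) := by
      intro e₁ e₂ e₃ e₄ e₅ e₆ h h'
      have h3 : e₁ - e₅ = (e₁ - e₂) - (e₅ - e₂) := by abel
      rw [h3, h, h']
      module
    exact this _ _ _ _ _ _ e e'
  -- every point of the parametrisation depends on `y` only
  have hpt : ∀ (b : ℝ), b ^ Fintype.card G ≠ 1 → ∀ y,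
      diffVec U α β q' (psiX U (α r) (α r') (β r) (β r') b ((1 - b ^ Fintype.card G)⁻¹ • y)) y =
      lam • diffVec U α β q
        (psiX U (α r) (α r') (β r) (β r') b ((1 - b ^ Fintype.card G)⁻¹ • y)) y := by
    intro b hb y
    have := hall b ((1 - b ^ Fintype.card G)⁻¹ • y)
    rwa [psiVec, psiVec, smul_smul, mul_inv_cancel₀ (sub_ne_zero.2 hb.symm), one_smul] at this
  have hrel : ∀ (b : ℝ), b ^ Fintype.card G ≠ 1 → ∀ y,
      diffVec U α β r (psiX U (α r) (α r') (β r) (β r') b ((1 - b ^ Fintype.card G)⁻¹ • y)) y =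
      b • diffVec U α β r'
        (psiX U (α r) (α r') (β r) (β r') b ((1 - b ^ Fintype.card G)⁻¹ • y)) y := by
    intro b hb y
    have := psiVec_rel (U := U) (α := α) (β := β) r r' b ((1 - b ^ Fintype.card G)⁻¹ • y)
    rwa [psiVec, psiVec, smul_smul, mul_inv_cancel₀ (sub_ne_zero.2 hb.symm), one_smul] at this
  obtain ⟨b, y, hb, hby⟩ := hne
  have hb1 := sub_ne_zero.2 hb.symm
  -- compare the ratios `b`, `0` and `2`
  have h20 : (2 : ℝ) ^ Fintype.card G ≠ 1 := (one_lt_pow₀ one_lt_two hN).ne'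
  set y' := (1 - b ^ Fintype.card G) • y with hy'
  have hyy : y = (1 - b ^ Fintype.card G)⁻¹ • y' := by
    rw [hy', smul_smul, inv_mul_cancel₀ hb1, one_smul]
  have i0 := hrel 0 h00 y'
  have i2 := hrel 2 h20 y'
  rw [hinj _ _ _ (hpt 2 h20 y') (hpt 0 h00 y'), i0, zero_smul] at i2
  have i3 := (smul_eq_zero.1 i2.symm).resolve_left two_ne_zero
  apply hby
  have e : psiVec U α β r r' r' b y = diffVec U α β r'
      (psiX U (α r) (α r') (β r) (β r') b ((1 - b ^ Fintype.card G)⁻¹ • y')) y' := by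
    rw [psiVec, ← hyy]
  rw [e, hinj _ _ _ (hpt b hb y') (hpt 0 h00 y'), i3]

lemma polySmall_of_kernel (hp : d ≤ p) {r r' : Q} (q₁ q₂ : Fin p → Q) (h₁ : ∀ i, col (q₁ i) = i)
    (h₂ : ∀ i, col (q₂ i) = i) (hq : ∀ i, NoEig U ((α (q₂ i))⁻¹ * α (q₁ i)))
    (hR : ∀ q q', col q = col q' → ∀ c z, Par (psiVec U α β r r' q c z) (psiVec U α β r r' q' c z))
    {x₁ z₁ : Euc d} (hz₁ : z₁ ≠ 0) (h : diffVec U α β r x₁ z₁ = 0)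
    (h' : diffVec U α β r' x₁ z₁ = 0) :
    PolySmall {w : Fin p → Euc d | ∃ x y, Bad U col α β w x y ∧ ∃ c : ℝ,
      c ^ Fintype.card G ≠ 1 ∧ diffVec U α β r x y = c • diffVec U α β r' x y} := by
  classical
  by_cases hne : ∃ c z, c ^ Fintype.card G ≠ 1 ∧ psiVec U α β r r' r' c z ≠ 0
  swap
  · refine PolySmall.empty.mono ?_
    rintro w ⟨x, y, hbad, c, hc, hxy⟩
    refine hne ⟨c, (1 - c ^ Fintype.card G)⁻¹ • y, hc, ?_⟩
    rw [psiVec_surj hc hxy]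
    exact (hbad r').1
  obtain ⟨k, hk⟩ := exists_coord_ne_zero hz₁
  let z₀ : (Fin d → ℝ) → Euc d := fun s => WithLp.toLp 2 fun j => Function.update s k 0 j
  have hz₀ : VPoly z₀ := VPoly.update (v := id) k 0
  let v : Fin p → (Fin d → ℝ) → Euc d := fun i s =>
    if diffVec U α β (q₁ i) x₁ z₁ = 0 then psiVec U α β r r' (q₁ i) (s k) (z₀ s)
    else diffVec U α β (q₁ i) x₁ z₁
  have hv : ∀ i, VPoly (v i) := by
    intro i
    simp only [v]
    split_ifs
    · exact VPoly.psiVec r r' (q₁ i) (PolyFun.coord k) hz₀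
    · exact VPoly.const _
  refine (incidence (σ := Fin d) (∅ : Finset (Fin p)) (by simpa using hp)
    (h := fun s => ∑ j, z₀ s j ^ 2 - 1) ((PolyFun.sum _ fun j _ => (hz₀ j).pow 2).sub
      (PolyFun.const 1)) ⟨0, by simp [z₀]⟩ hv hv).mono ?_
  rintro w ⟨x, y, hbad, c, hc, hxy⟩
  have hc1 := sub_ne_zero.2 hc.symm
  set z := (1 - c ^ Fintype.card G)⁻¹ • y with hz
  have hzq : ∀ q, psiVec U α β r r' q c z = diffVec U α β q x y := psiVec_surj hc hxy
  set t := z k / z₁ k with ht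
  set y₀ := z - t • z₁ with hy₀
  have hy₀k : y₀ k = 0 := by
    simp only [hy₀, ht, PiLp.sub_apply, PiLp.smul_apply, smul_eq_mul]
    field_simp
    ring
  have hy₀q : ∀ q, diffVec U α β q x y = psiVec U α β r r' q c y₀ +
      (t * (1 - c ^ Fintype.card G)) • diffVec U α β q x₁ z₁ := by
    intro q
    rw [← hzq q, mul_smul, ← psiVec_kernel h h' q hc, ← psiVec_smul, ← psiVec_add, hy₀,
      sub_add_cancel]
  have hy₀0 : (fun j => y₀ j) ≠ 0 := by
    intro h0
    have h00 : y₀ = 0 := by ext j; exact congrFun h0 j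
    apply (hbad r').1
    rw [hy₀q, h00, h', smul_zero, add_zero]
    simp [psiVec, diffVec]
  obtain ⟨a, ha, ha1⟩ := exists_normalise hy₀0
  have hz₀a : z₀ (Function.update (fun j => a * y₀ j) k c) = a • y₀ := by
    ext j
    by_cases hj : j = k
    · subst hj; simp [z₀, hy₀k]
    · simp [z₀, hj]
  refine ⟨Function.update (fun j => a * y₀ j) k c, ?_, fun i => ?_, by simp⟩
  · rw [hz₀a]; exact ha1
  · obtain ⟨hn, hi⟩ := hbad (q₁ i)
    rw [h₁] at hi
    by_cases h0 : diffVec U α β (q₁ i) x₁ z₁ = 0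
    · simp only [v, if_pos h0, hz₀a, Function.update_self, psiVec_smul]
      rw [hy₀q, h0, smul_zero, add_zero] at hn hi
      exact ⟨smul_ne_zero ha hn, by rw [inner_smul_right, hi, mul_zero]⟩
    · simp only [v, if_neg h0]
      refine ⟨h0, ?_⟩
      have hpar := par_kernel_psiVec (col := col) hR h h' hne (by rw [h₁, h₂]) (hq i) hc z
      rw [hzq] at hpar
      obtain ⟨b, hb⟩ := hpar.symm.exists_smul hn
      rw [hb, inner_smul_right, hi, mul_zero]

variable (U α β) in
/-- The composite `U_{α q}⁻¹ U_{β q}`. -/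
noncomputable def relLin (q : Q) : Euc d →ₗ[ℝ] Euc d := actLin U (α q)⁻¹ ∘ₗ actLin U (β q)

lemma diffVec_eq (q : Q) (x y : Euc d) :
    diffVec U α β q x y = U (α q) (x - relLin U α β q y) := by
  simp only [diffVec, relLin, LinearMap.comp_apply, actLin_apply, map_sub, act_act_inv]

variable (U α β) in
/-- Coefficient of the ratio in the difference vector `q`, in terms of the base vector. -/
noncomputable def slopeLin (r r' : Q) (Di : Euc d →ₗ[ℝ] Euc d) (q : Q) : Euc d →ₗ[ℝ] Euc d :=
  actLin U (α q) ∘ₗ (relLin U α β r' - relLin U α β q) ∘ₗ Di ∘ₗ actLin U (α r)⁻¹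

variable (U α β) in
/-- Constant coefficient of the difference vector `q`, in terms of the base vector. -/
noncomputable def constLin (r r' : Q) (Di : Euc d →ₗ[ℝ] Euc d) (q : Q) : Euc d →ₗ[ℝ] Euc d :=
  -(actLin U (α q) ∘ₗ (relLin U α β r - relLin U α β q) ∘ₗ Di ∘ₗ actLin U (α r')⁻¹)

variable (U α β) in
/-- Second component of the point with base vectors `c • z` and `z`. -/
noncomputable def baseY (r r' : Q) (Di : Euc d →ₗ[ℝ] Euc d) (c : ℝ) : Euc d →ₗ[ℝ] Euc d :=
  c • (Di ∘ₗ actLin U (α r)⁻¹) - Di ∘ₗ actLin U (α r')⁻¹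

variable (U α β) in
/-- First component of the point with base vectors `c • z` and `z`. -/
noncomputable def baseX (r r' : Q) (Di : Euc d →ₗ[ℝ] Euc d) (c : ℝ) : Euc d →ₗ[ℝ] Euc d :=
  c • (relLin U α β r' ∘ₗ Di ∘ₗ actLin U (α r)⁻¹) -
    relLin U α β r ∘ₗ Di ∘ₗ actLin U (α r')⁻¹

lemma polyLin_baseY (r r' : Q) (Di : Euc d →ₗ[ℝ] Euc d) : PolyLin (baseY U α r r' Di) :=
  fun hc hz => (VPoly.smul hc (VPoly.map (Di ∘ₗ actLin U (α r)⁻¹) hz)).sub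
    (VPoly.map (Di ∘ₗ actLin U (α r')⁻¹) hz)

lemma polyLin_baseX (r r' : Q) (Di : Euc d →ₗ[ℝ] Euc d) : PolyLin (baseX U α β r r' Di) :=
  fun hc hz => (VPoly.smul hc (VPoly.map (relLin U α β r' ∘ₗ Di ∘ₗ actLin U (α r)⁻¹) hz)).sub
    (VPoly.map (relLin U α β r ∘ₗ Di ∘ₗ actLin U (α r')⁻¹) hz)

lemma diffVec_base (r r' : Q) (Di : Euc d →ₗ[ℝ] Euc d) (q : Q) (c : ℝ) (z : Euc d) :
    diffVec U α β q (baseX U α β r r' Di c z) (baseY U α r r' Di c z) =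
      constLin U α β r r' Di q z + c • slopeLin U α β r r' Di q z := by
  rw [diffVec_eq, ← actLin_apply]
  simp only [baseX, baseY, constLin, slopeLin, LinearMap.sub_apply, LinearMap.smul_apply,
    LinearMap.comp_apply, LinearMap.neg_apply, map_sub, map_smul]
  module

lemma base_surj {r r' : Q} {Di : Euc d →ₗ[ℝ] Euc d}
    (h₁ : ∀ v, relLin U α β r' (Di v) - relLin U α β r (Di v) = v)
    (h₂ : ∀ v, Di (relLin U α β r' v - relLin U α β r v) = v)
    {x y : Euc d} {c : ℝ} (h : diffVec U α β r x y = c • diffVec U α β r' x y) :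
    baseX U α β r r' Di c (diffVec U α β r' x y) = x ∧
      baseY U α r r' Di c (diffVec U α β r' x y) = y := by
  have e1 : U (α r)⁻¹ (diffVec U α β r x y) = x - relLin U α β r y := by
    rw [diffVec_eq, act_inv_act]
  have e2 : U (α r')⁻¹ (diffVec U α β r' x y) = x - relLin U α β r' y := by
    rw [diffVec_eq, act_inv_act]
  rw [h, map_smul] at e1
  have e3 : baseY U α r r' Di c (diffVec U α β r' x y) = y := by
    simp only [baseY, LinearMap.sub_apply, LinearMap.smul_apply, LinearMap.comp_apply,
      actLin_apply]
    rw [← map_smul, e1, e2, ← map_sub]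
    convert h₂ y using 2
    abel
  refine ⟨?_, e3⟩
  have e4 : baseX U α β r r' Di c (diffVec U α β r' x y) =
      relLin U α β r (baseY U α r r' Di c (diffVec U α β r' x y)) +
        c • (relLin U α β r' (Di (U (α r)⁻¹ (diffVec U α β r' x y))) -
          relLin U α β r (Di (U (α r)⁻¹ (diffVec U α β r' x y)))) := by
    simp only [baseX, baseY, LinearMap.sub_apply, LinearMap.smul_apply, LinearMap.comp_apply,
      actLin_apply, map_sub, map_smul]
    module
  rw [e4, h₁, e3, e1]
  abel

lemma slope_add_const {r r' : Q} {Di : Euc d →ₗ[ℝ] Euc d}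
    (h₁ : ∀ v, relLin U α β r' (Di v) - relLin U α β r (Di v) = v) (q : Q) (v : Euc d) :
    slopeLin U α β r r' Di q (U (α r) v) + constLin U α β r r' Di q (U (α r') v) = U (α q) v := by
  simp only [slopeLin, constLin, LinearMap.comp_apply, LinearMap.neg_apply, LinearMap.sub_apply,
    actLin_apply, act_inv_act, ← map_neg, ← map_add]
  congr 1
  conv_rhs => rw [← h₁ v]
  abel

lemma constLin_base {r r' : Q} {Di : Euc d →ₗ[ℝ] Euc d}
    (h₁ : ∀ v, relLin U α β r' (Di v) - relLin U α β r (Di v) = v) (z : Euc d) :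
    constLin U α β r r' Di r' z = z := by
  simp only [constLin, LinearMap.comp_apply, LinearMap.neg_apply, LinearMap.sub_apply,
    actLin_apply, ← map_neg, neg_sub]
  rw [h₁, act_act_inv]

lemma slopeLin_base (r r' : Q) (Di : Euc d →ₗ[ℝ] Euc d) (z : Euc d) :
    slopeLin U α β r r' Di r' z = 0 := by
  simp [slopeLin]

lemma exists_smul_pair {P R P' R' : Euc d →ₗ[ℝ] Euc d}
    (h : ∀ (c : ℝ) z, Par (R z + c • P z) (R' z + c • P' z)) {z₀ z₁ z₂ : Euc d}
    (h₀ : ¬ Par (P z₀) (R z₀)) (h₁₂ : ¬ Par (P z₁) (P z₂)) :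
    ∃ lam : ℝ, P' = lam • P ∧ R' = lam • R := by
  have hc : ∀ z, Par (P z) (P' z) := by
    intro z j l
    have e0 := h 0 z j l
    have e1 := h 1 z j l
    have e2 := h (-1) z j l
    simp only [PiLp.add_apply, PiLp.smul_apply, smul_eq_mul] at e0 e1 e2
    linear_combination (e1 + e2) / 2 - e0
  obtain ⟨lam, hlam⟩ := exists_smul_of_forall_par hc h₁₂
  refine ⟨lam, hlam, ?_⟩
  have hz : ∀ z, ¬ Par (P z) (R z) → R' z = lam • R z := by
    intro z hz
    rw [← sub_eq_zero]
    refine eq_zero_of_par_of_par hz (fun j l => ?_) (fun j l => ?_)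
    · have e1 := h 1 z j l
      have e2 := h (-1) z j l
      simp only [hlam, LinearMap.smul_apply, PiLp.add_apply, PiLp.sub_apply, PiLp.smul_apply,
        smul_eq_mul] at e1 e2 ⊢
      linear_combination (e1 - e2) / 2
    · have e0 := h 0 z j l
      simp only [hlam, LinearMap.smul_apply, PiLp.add_apply, PiLp.sub_apply, PiLp.smul_apply,
        smul_eq_mul] at e0 ⊢
      linear_combination e0
  ext z k
  simp only [Par, not_forall] at h₀
  obtain ⟨j, l, hjl⟩ := h₀
  have hx : VPoly fun s : Fin d → ℝ => (WithLp.toLp 2 s : Euc d) := fun j => PolyFun.coord j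
  have key := PolyFun.eq_zero_of_mul_eq_zero
    (PolyFun.minor (VPoly.map P hx) (VPoly.map R hx) j l)
    ((VPoly.map R' hx k).sub ((PolyFun.const lam).mul (VPoly.map R hx k))) ?_
    ⟨fun j => z₀ j, sub_ne_zero.2 hjl⟩ (fun j => z j)
  · exact sub_eq_zero.1 key
  · intro s
    by_cases h2 : Par (P (WithLp.toLp 2 s)) (R (WithLp.toLp 2 s))
    · rw [sub_eq_zero.2 (h2 j l), zero_mul]
    · beta_reduce
      rw [hz _ h2]; simp

lemma finrank_range_le_one_of_par {f : Euc d →ₗ[ℝ] Euc d} (h : ∀ z z', Par (f z) (f z')) :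
    Module.finrank ℝ (LinearMap.range f) ≤ 1 := by
  by_cases h0 : ∃ z, f z ≠ 0
  · obtain ⟨z, hz⟩ := h0
    refine finrank_le_one ⟨f z, z, rfl⟩ ?_
    rintro ⟨_, z', rfl⟩
    obtain ⟨c, hc⟩ := (h z z').exists_smul hz
    exact ⟨c, Subtype.ext hc.symm⟩
  · push Not at h0
    have : f = 0 := LinearMap.ext h0
    rw [this, LinearMap.range_zero, finrank_bot]
    exact zero_le_one

lemma act_two_coord (U : G →* (Euc 2 ≃ₗᵢ[ℝ] Euc 2)) (g : G) (x : Euc 2) (i : Fin 2) :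
    U g x i = x 0 * U g (EuclideanSpace.single 0 1) i +
      x 1 * U g (EuclideanSpace.single 1 1) i := by
  have h : x = x 0 • EuclideanSpace.single 0 1 + x 1 • EuclideanSpace.single 1 1 := by
    ext j
    fin_cases j <;> simp
  conv_lhs => rw [h, map_add, map_smul, map_smul]
  simp

lemma det_two (U : G →* (Euc 2 ≃ₗᵢ[ℝ] Euc 2)) (g : G) :
    LinearMap.det (actLin U g) =
      U g (EuclideanSpace.single 0 1) 0 * U g (EuclideanSpace.single 1 1) 1 -
        U g (EuclideanSpace.single 1 1) 0 * U g (EuclideanSpace.single 0 1) 1 := by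
  rw [← LinearMap.det_toMatrix (EuclideanSpace.basisFun (Fin 2) ℝ).toBasis, Matrix.det_fin_two]
  simp [LinearMap.toMatrix_apply]

lemma exists_eigen_of_det_neg (hd : d = 2) {g : G} (h : LinearMap.det (actLin U g) < 0) :
    ∃ (c : ℝ) (x : Euc d), x ≠ 0 ∧ U g x = c • x := by
  subst hd
  rw [det_two] at h
  have hx0 := fun x => act_two_coord U g x 0
  have hx1 := fun x => act_two_coord U g x 1
  generalize U g (EuclideanSpace.single 0 1) 0 = a at h hx0 hx1
  generalize U g (EuclideanSpace.single 0 1) 1 = c at h hx0 hx1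
  generalize U g (EuclideanSpace.single 1 1) 0 = b at h hx0 hx1
  generalize U g (EuclideanSpace.single 1 1) 1 = e at h hx0 hx1
  by_cases hb : b = 0
  · refine ⟨e, EuclideanSpace.single 1 1, by simp, ?_⟩
    ext i
    fin_cases i <;> simp [hx0, hx1, hb]
  · obtain ⟨t, ht⟩ : ∃ t : ℝ, t ^ 2 - (a + e) * t + (a * e - b * c) = 0 := by
      refine ⟨((a + e) + √((a + e) ^ 2 - 4 * (a * e - b * c))) / 2, ?_⟩
      have h1 := Real.sq_sqrt (show 0 ≤ (a + e) ^ 2 - 4 * (a * e - b * c) by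
        nlinarith [sq_nonneg (a + e)])
      linear_combination h1 / 4
    refine ⟨t, !₂[b, t - a], fun h0 => hb (by simpa using congrArg (fun v => v 0) h0), ?_⟩
    ext i
    fin_cases i
    · simp [hx0]; ring
    · simp [hx1]; linear_combination -ht

lemma det_neg_of_fixed (hd : d = 2) {g : G} {v : Euc d} (hv : v ≠ 0) (h : U g v = v)
    (hne : ∃ x, U g x ≠ x) : LinearMap.det (actLin U g) < 0 := by
  subst hd
  rw [det_two]
  have hx0 := fun x => act_two_coord U g x 0
  have hx1 := fun x => act_two_coord U g x 1
  have h11 := (U g).inner_map_map (EuclideanSpace.single 0 1) (EuclideanSpace.single 0 1)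
  have h12 := (U g).inner_map_map (EuclideanSpace.single 0 1) (EuclideanSpace.single 1 1)
  have h22 := (U g).inner_map_map (EuclideanSpace.single 1 1) (EuclideanSpace.single 1 1)
  have hv0 := congrArg (fun v => v 0) h
  have hv1 := congrArg (fun v => v 1) h
  beta_reduce at hv0 hv1
  rw [hx0] at hv0
  rw [hx1] at hv1
  simp only [inner_eq_sum, Fin.sum_univ_two] at h11 h12 h22
  simp at h11 h12 h22
  generalize U g (EuclideanSpace.single 0 1) 0 = a at *
  generalize U g (EuclideanSpace.single 0 1) 1 = c at *
  generalize U g (EuclideanSpace.single 1 1) 0 = b at *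
  generalize U g (EuclideanSpace.single 1 1) 1 = e at *
  have hpos : 0 < v 0 ^ 2 + v 1 ^ 2 := by
    rcases (by positivity : 0 ≤ v 0 ^ 2 + v 1 ^ 2).eq_or_lt with h0 | h0
    · refine absurd ?_ hv
      ext i
      fin_cases i <;> simp <;> nlinarith [sq_nonneg (v 0), sq_nonneg (v 1)]
    · exact h0
  have hdet : (a * e - b * c) ^ 2 = 1 := by
    linear_combination (e ^ 2 + b ^ 2) * h11 + h22 - (a * b + c * e) * h12
  rcases sq_eq_one_iff.1 hdet with h1 | h1
  · exfalso
    have he : a = e := by linear_combination -a * h1 + e * h11 - c * h12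
    have hb : b = -c := by linear_combination (-c) * h1 - b * h11 + a * h12
    subst he hb
    have h2 : ((a - 1) ^ 2 + c ^ 2) * (v 0 ^ 2 + v 1 ^ 2) = 0 := by
      linear_combination (v 0 * (a - 1) - v 1 * c) * hv0 + (v 0 * c + v 1 * (a - 1)) * hv1
    have h3 := (mul_eq_zero.1 h2).resolve_right hpos.ne'
    have ha : a = 1 := by nlinarith [sq_nonneg (a - 1), sq_nonneg c]
    have hc : c = 0 := by nlinarith [sq_nonneg (a - 1), sq_nonneg c]
    obtain ⟨x, hx⟩ := hne
    refine hx ?_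
    ext i
    fin_cases i
    · simp [hx0, ha, hc]
    · simp [hx1, ha, hc]
  · linarith

lemma relLin_apply (q : Q) (x : Euc d) : relLin U α β q x = U ((α q)⁻¹ * β q) x :=
  (act_mul U _ _ x).symm

lemma det_actLin_mul (g h : G) :
    LinearMap.det (actLin U (g * h)) = LinearMap.det (actLin U g) * LinearMap.det (actLin U h) := by
  rw [← LinearMap.det_comp]
  congr 1
  ext1 x
  exact act_mul U g h x

lemma det_actLin_one : LinearMap.det (actLin U 1) = 1 := by
  rw [show actLin U 1 = LinearMap.id from LinearMap.ext (act_one U), LinearMap.det_id]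

lemma det_actLin_ne_zero (g : G) : LinearMap.det (actLin U g) ≠ 0 := by
  intro h
  have h1 := det_actLin_mul (U := U) g g⁻¹
  rw [mul_inv_cancel, det_actLin_one, h, zero_mul] at h1
  exact one_ne_zero h1

lemma card_le_of_det_neg (hd : d = 2) {g₀ g : G} (h₀ : LinearMap.det (actLin U g₀) < 0)
    (hg : NoEig U g) {K : Type} {f : K → G} (hf : Function.Injective f)
    (h : ∀ k, ∃ μ ν : ℝ, ∀ v, U (f k) v = μ • U g v + ν • v) :
    Nat.card K ≤ Nat.card {g : G // g ≠ 1 ∧ rankMin U g < d} := by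
  have h1 : ∀ k, 0 < LinearMap.det (actLin U (f k)) := by
    intro k
    by_contra hk
    have hk := lt_of_le_of_ne (not_lt.1 hk) (det_actLin_ne_zero (f k))
    obtain ⟨c, x, hx, hc⟩ := exists_eigen_of_det_neg hd hk
    obtain ⟨μ, ν, hv⟩ := h k
    rcases eq_or_ne μ 0 with rfl | hμ
    · have h2 : actLin U (f k) = ν • LinearMap.id := by
        ext1 v
        simp [hv]
      rw [h2, LinearMap.det_smul, LinearMap.det_id, finrank_euclideanSpace_fin, hd] at hk
      nlinarith [sq_nonneg ν]
    · refine hx (hg (μ⁻¹ * (c - ν)) x ?_)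
      rw [hv] at hc
      rw [mul_smul, sub_smul, ← hc, add_sub_cancel_right, inv_smul_smul₀ hμ]
  refine Nat.card_le_card_of_injective
    (fun k => ⟨g₀ * f k, ?_⟩) fun k k' hk => hf (mul_left_cancel (congrArg Subtype.val hk))
  have h2 : LinearMap.det (actLin U (g₀ * f k)) < 0 := by
    rw [det_actLin_mul]
    exact mul_neg_of_neg_of_pos h₀ (h1 k)
  refine ⟨fun h3 => ?_, ?_⟩
  · rw [h3, det_actLin_one] at h2
    linarith
  · obtain ⟨c, x, hx, hc⟩ := exists_eigen_of_det_neg hd h2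
    exact rankMin_lt_of_eigen hx hc

lemma Par.swap_pencil {a b a' b' : Euc d} (h : ∀ c : ℝ, Par (a + c • b) (a' + c • b')) (c : ℝ) :
    Par (b + c • a) (b' + c • a') := by
  intro j l
  have e0 := h 0 j l
  have e1 := h 1 j l
  have e2 := h (-1) j l
  simp only [PiLp.add_apply, PiLp.smul_apply, smul_eq_mul] at e0 e1 e2 ⊢
  linear_combination (e1 + e2) / 2 - e0 + c * (e1 - e2) / 2 + c ^ 2 * e0

lemma Par.coeff_of_pencil {a b u : Euc d} (h : ∀ c : ℝ, Par u (a + c • b)) :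
    Par u a ∧ Par u b := by
  refine ⟨fun j l => ?_, fun j l => ?_⟩ <;> have e0 := h 0 j l <;> have e1 := h 1 j l <;>
    simp only [PiLp.add_apply, PiLp.smul_apply, smul_eq_mul] at e0 e1
  · linear_combination e0
  · linear_combination e1 - e0

lemma exists_not_par (hd : 2 ≤ d) : ∃ u v : Euc d, ¬ Par u v := by
  refine ⟨EuclideanSpace.single ⟨0, by omega⟩ 1, EuclideanSpace.single ⟨1, by omega⟩ 1,
    fun h => ?_⟩
  have := h ⟨0, by omega⟩ ⟨1, by omega⟩
  simp at this

/-- If all same-column difference vectors are parallel along the base parametrisation, then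
the two coefficients of each one are parallel. -/
lemma par_slope_const (hd : 2 ≤ d) {r r' : Q} {Di : Euc d →ₗ[ℝ] Euc d}
    (h₁ : ∀ v, relLin U α β r' (Di v) - relLin U α β r (Di v) = v)
    (hr : NoEig U ((α r')⁻¹ * α r))
    (hinj : ∀ k k', col k = col r' → col k' = col r' → α k = α k' → k = k')
    (hcount : Nat.card {g : G // g ≠ 1 ∧ rankMin U g < d} < Nat.card {k // col k = col r'})
    (hR : ∀ q q', col q = col q' → ∀ (c : ℝ) z,
      Par (constLin U α β r r' Di q z + c • slopeLin U α β r r' Di q z)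
        (constLin U α β r r' Di q' z + c • slopeLin U α β r r' Di q' z))
    {q q' : Q} (hqq : col q = col q') (hq : NoEig U ((α q')⁻¹ * α q)) (z₀ : Euc d) :
    Par (slopeLin U α β r r' Di q z₀) (constLin U α β r r' Di q z₀) := by
  by_contra h₀
  have hprop : ∀ lam : ℝ, slopeLin U α β r r' Di q' = lam • slopeLin U α β r r' Di q →
      constLin U α β r r' Di q' = lam • constLin U α β r r' Di q → False := by
    intro lam e1 e2
    have hz : ∀ v : Euc d, v = 0 := by
      intro v
      refine hq.eq_zero (c := lam) ?_
      rw [← slope_add_const h₁ q, ← slope_add_const h₁ q', e1, e2]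
      simp
    obtain ⟨u, v, huv⟩ := exists_not_par hd
    exact huv (by rw [hz u, hz v]; exact Par.self _)
  have hP : ∀ z z', Par (slopeLin U α β r r' Di q z) (slopeLin U α β r r' Di q z') := by
    by_contra! h
    obtain ⟨z₁, z₂, h⟩ := h
    obtain ⟨lam, e1, e2⟩ := exists_smul_pair (hR q q' hqq) h₀ h
    exact hprop lam e1 e2
  have hC : ∀ z z', Par (constLin U α β r r' Di q z) (constLin U α β r r' Di q z') := by
    by_contra! h
    obtain ⟨z₁, z₂, h⟩ := h
    obtain ⟨lam, e1, e2⟩ := exists_smul_pair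
      (fun c z => Par.swap_pencil (fun c => hR q q' hqq c z) c) (fun h => h₀ h.symm) h
    exact hprop lam e2 e1
  have hP1 := finrank_range_le_one_of_par hP
  have hd2 : d = 2 := by
    refine le_antisymm ?_ hd
    have h2 := finrank_range_le_one_of_par hC
    have h3 : LinearMap.range (slopeLin U α β r r' Di q) ⊔
        LinearMap.range (constLin U α β r r' Di q) = ⊤ := by
      rw [eq_top_iff]
      rintro u -
      rw [← act_act_inv U (α q) u, ← slope_add_const h₁]
      exact Submodule.add_mem_sup ⟨_, rfl⟩ ⟨_, rfl⟩
    have h4 := Submodule.finrank_add_le_finrank_add_finrank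
      (LinearMap.range (slopeLin U α β r r' Di q)) (LinearMap.range (constLin U α β r r' Di q))
    rw [h3, finrank_top, finrank_euclideanSpace_fin] at h4
    omega
  obtain ⟨v, hv0, hv⟩ : ∃ v : Euc d, v ≠ 0 ∧ relLin U α β r' v = relLin U α β q v := by
    have h1 := LinearMap.finrank_range_add_finrank_ker (slopeLin U α β r r' Di q)
    rw [finrank_euclideanSpace_fin] at h1
    have h2 : 0 < Module.finrank ℝ (LinearMap.ker (slopeLin U α β r r' Di q)) := by omega
    rw [Module.finrank_pos_iff_exists_ne_zero] at h2
    obtain ⟨⟨z, hz⟩, hz0⟩ := h2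
    refine ⟨Di (U (α r)⁻¹ z), fun h => hz0 ?_, ?_⟩
    · have h3 := h₁ (U (α r)⁻¹ z)
      rw [h, map_zero, map_zero, sub_zero] at h3
      exact Subtype.ext ((U (α r)⁻¹).injective (by rw [← h3]; simp))
    · refine sub_eq_zero.1 ((U (α q)).injective ?_)
      rw [map_zero]
      exact hz
  have hdet := det_neg_of_fixed (U := U) (g := ((α q)⁻¹ * β q)⁻¹ * ((α r')⁻¹ * β r')) hd2 hv0
    (by rw [act_mul, ← relLin_apply, hv, relLin_apply, act_inv_act])
    (by
      by_contra! h
      refine h₀ ?_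
      have h1 : ∀ y, relLin U α β r' y = relLin U α β q y := by
        intro y
        have h2 := congrArg (U ((α q)⁻¹ * β q)) (h y)
        rwa [act_mul U ((α q)⁻¹ * β q)⁻¹, act_act_inv, ← relLin_apply, ← relLin_apply] at h2
      have h2 : slopeLin U α β r r' Di q z₀ = 0 := by
        simp [slopeLin, h1]
      rw [h2]
      exact Par.zero_left _)
  refine absurd hcount (not_lt.2 (card_le_of_det_neg hd2 hdet hr
    (f := fun k : {k // col k = col r'} => (α r')⁻¹ * α k)
    (fun k k' h => Subtype.ext (hinj _ _ k.2 k'.2 (mul_left_cancel h))) ?_))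
  rintro ⟨k, hk⟩
  have h2 : ∀ z, Par z (constLin U α β r r' Di k z) ∧ Par z (slopeLin U α β r r' Di k z) := by
    intro z
    refine Par.coeff_of_pencil fun c => ?_
    have := hR r' k hk.symm c z
    rwa [constLin_base h₁, slopeLin_base, smul_zero, add_zero] at this
  obtain ⟨u, v, huv⟩ := exists_not_par hd
  obtain ⟨ν, hν⟩ := exists_smul_of_forall_par (f := LinearMap.id) (fun z => (h2 z).1) huv
  obtain ⟨μ, hμ⟩ := exists_smul_of_forall_par (f := LinearMap.id) (fun z => (h2 z).2) huv
  refine ⟨μ, ν, fun v => ?_⟩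
  rw [act_mul, ← slope_add_const h₁ k, hμ, hν]
  simp

lemma polySmall_of_base (hp : d ≤ p) {r r' : Q} {Di : Euc d →ₗ[ℝ] Euc d}
    (h₁ : ∀ v, relLin U α β r' (Di v) - relLin U α β r (Di v) = v)
    (h₂ : ∀ v, Di (relLin U α β r' v - relLin U α β r v) = v)
    (q₁ : Fin p → Q) (hq₁ : ∀ i, col (q₁ i) = i)
    (hpar : ∀ i z, Par (slopeLin U α β r r' Di (q₁ i) z) (constLin U α β r r' Di (q₁ i) z)) :
    PolySmall {w : Fin p → Euc d | ∃ x y, Bad U col α β w x y ∧ ∃ c : ℝ,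
      diffVec U α β r x y = c • diffVec U α β r' x y} := by
  have hz : VPoly fun s : Fin d → ℝ => (WithLp.toLp 2 s : Euc d) := fun j => PolyFun.coord j
  have hfam := fun e : Fin p → Bool =>
    have hv : ∀ i, VPoly fun s : Fin d → ℝ => (if e i then slopeLin U α β r r' Di (q₁ i)
        else constLin U α β r r' Di (q₁ i)) (WithLp.toLp 2 s) := fun i => VPoly.map _ hz
    incidence (σ := Fin d) (∅ : Finset (Fin p)) (by simpa using hp)
      (h := fun s => ∑ j, s j ^ 2 - 1) ((PolyFun.sum _ fun j _ => (PolyFun.coord j).pow 2).sub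
      (PolyFun.const 1)) ⟨0, by simp⟩ hv hv
  refine (PolySmall.iUnion hfam).mono ?_
  rintro w ⟨x, y, hbad, c, hxy⟩
  set z := diffVec U α β r' x y with hzdef
  have hzq : ∀ q, diffVec U α β q x y =
      constLin U α β r r' Di q z + c • slopeLin U α β r r' Di q z := by
    intro q
    obtain ⟨e1, e2⟩ := base_surj h₁ h₂ hxy
    rw [← diffVec_base, e1, e2]
  have hz0 : (fun j => z j) ≠ 0 := fun h0 => (hbad r').1 (by ext j; exact congrFun h0 j)
  obtain ⟨a, ha, ha1⟩ := exists_normalise hz0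
  have hch : ∀ i, ∃ b : Bool, (if b then slopeLin U α β r r' Di (q₁ i)
        else constLin U α β r r' Di (q₁ i)) z ≠ 0 ∧ ⟪w i, (if b then slopeLin U α β r r' Di (q₁ i)
        else constLin U α β r r' Di (q₁ i)) z⟫ = 0 := by
    intro i
    obtain ⟨hn, hi⟩ := hbad (q₁ i)
    rw [hq₁, hzq] at hi
    rw [hzq] at hn
    by_cases hs : slopeLin U α β r r' Di (q₁ i) z = 0
    · refine ⟨false, ?_⟩
      rw [hs, smul_zero, add_zero] at hn hi
      exact ⟨by simpa using hn, by simpa using hi⟩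
    · refine ⟨true, by simpa using hs, ?_⟩
      obtain ⟨b, hb⟩ := (hpar i z).exists_smul hs
      rw [hb, ← add_smul] at hn hi
      rw [inner_smul_right] at hi
      simpa using (mul_eq_zero.1 hi).resolve_left fun h => hn (by rw [h, zero_smul])
  choose e he he' using hch
  refine Set.mem_iUnion.2 ⟨e, fun j => a * z j, by simpa [sub_eq_zero] using ha1, fun i => ?_, by simp⟩
  have haz : (WithLp.toLp 2 fun j => a * z j : Euc d) = a • z := rfl
  rw [haz, map_smul]
  exact ⟨smul_ne_zero ha (he i), by rw [inner_smul_right, he' i, mul_zero]⟩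

lemma polySmall_parallel_columns (hd : 2 ≤ d) (hp : d ≤ p) (hcol : Function.Surjective col)
    (q₁ q₂ : Fin p → Q) (hq₁ : ∀ i, col (q₁ i) = i) (hq₂ : ∀ i, col (q₂ i) = i)
    (hq : ∀ i, NoEig U ((α (q₂ i))⁻¹ * α (q₁ i))) (i₀ : Fin p)
    (hinj : ∀ k k', col k = i₀ → col k' = i₀ → α k = α k' → k = k')
    (hcount : Nat.card {g : G // g ≠ 1 ∧ rankMin U g < d} < Nat.card {k // col k = i₀}) :
    PolySmall {w : Fin p → Euc d | ∃ x y, Bad U col α β w x y ∧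
      (∀ i, ¬ NonParCol U col α β i x y) ∧ ∃ c : ℝ, c ^ Fintype.card G ≠ 1 ∧
        diffVec U α β (q₁ i₀) x y = c • diffVec U α β (q₂ i₀) x y} := by
  set r := q₁ i₀ with hr
  set r' := q₂ i₀ with hr'
  by_cases hD : Function.Injective (relLin U α β r' - relLin U α β r)
  · let e := LinearEquiv.ofInjectiveEndo _ hD
    let Di : Euc d →ₗ[ℝ] Euc d := e.symm
    have h₁ : ∀ v, relLin U α β r' (Di v) - relLin U α β r (Di v) = v := e.apply_symm_apply
    have h₂ : ∀ v, Di (relLin U α β r' v - relLin U α β r v) = v := e.symm_apply_apply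
    by_cases hR : ∀ q q', col q = col q' → ∀ (c : ℝ) z,
      Par (constLin U α β r r' Di q z + c • slopeLin U α β r r' Di q z)
        (constLin U α β r r' Di q' z + c • slopeLin U α β r r' Di q' z)
    · refine (polySmall_of_base hp h₁ h₂ q₁ hq₁ fun i z => ?_).mono ?_
      · refine par_slope_const hd h₁ (hq i₀) ?_ ?_ hR (by rw [hq₁, hq₂]) (hq i) z
        · rwa [hr', hq₂]
        · rwa [hr', hq₂]
      · rintro w ⟨x, y, hbad, -, c, -, hxy⟩
        exact ⟨x, y, hbad, c, hxy⟩
    · push Not at hR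
      obtain ⟨q, q', hqq, c, z, hne⟩ := hR
      refine (polySmall_of_minor (U := U) (α := α) (β := β) hcol hp (polyLin_baseX r r' Di)
        (polyLin_baseY r r' Di) hqq ⟨z, c, by rwa [diffVec_base, diffVec_base]⟩).mono ?_
      rintro w ⟨x, y, hbad, hpar, c, -, hxy⟩
      obtain ⟨e1, e2⟩ := base_surj h₁ h₂ hxy
      exact ⟨diffVec U α β r' x y, c, by rwa [e1, e2], by rwa [e1, e2]⟩
  · obtain ⟨z₁, hz, hz₁⟩ : ∃ z₁, relLin U α β r' z₁ = relLin U α β r z₁ ∧ z₁ ≠ 0 := by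
      rw [← LinearMap.ker_eq_bot, LinearMap.ker_eq_bot'] at hD
      push Not at hD
      obtain ⟨z₁, h, h0⟩ := hD
      exact ⟨z₁, sub_eq_zero.1 h, h0⟩
    by_cases hR : ∀ q q', col q = col q' → ∀ c z,
        Par (psiVec U α β r r' q c z) (psiVec U α β r r' q' c z)
    · refine (polySmall_of_kernel (x₁ := relLin U α β r z₁) hp q₁ q₂ hq₁ hq₂ hq hR hz₁
        ?_ ?_).mono ?_
      · rw [diffVec_eq, sub_self, map_zero]
      · rw [diffVec_eq, hz, sub_self, map_zero]
      · rintro w ⟨x, y, hbad, -, h⟩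
        exact ⟨x, y, hbad, h⟩
    · push Not at hR
      obtain ⟨q, q', hqq, c, z, hne⟩ := hR
      refine (polySmall_of_minor (U := U) (α := α) (β := β) hcol hp
        (X := psiX U (α r) (α r') (β r) (β r'))
        (Y := fun c => (1 - c ^ Fintype.card G) • LinearMap.id)
        (polyLin_psiX _ _ _ _) polyLin_psiY hqq ⟨z, c, hne⟩).mono ?_
      rintro w ⟨x, y, hbad, hpar, c, hc, hxy⟩
      have e1 := psiX_surj U (α r) (α r') (β r) (β r') hc hxy
      have e2 : y = (1 - c ^ Fintype.card G) • ((1 - c ^ Fintype.card G)⁻¹ • y) := by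
        rw [smul_smul, mul_inv_cancel₀ (sub_ne_zero.2 hc.symm), one_smul]
      refine ⟨(1 - c ^ Fintype.card G)⁻¹ • y, c, ?_, ?_⟩
      · rwa [← e1, LinearMap.smul_apply, LinearMap.id_apply, ← e2]
      · rwa [← e1, LinearMap.smul_apply, LinearMap.id_apply, ← e2]

lemma exists_pair_of_card {i : Fin p} {m : ℕ}
    (hinj : ∀ k k', col k = i → col k' = i → α k = α k' → k = k')
    (hcount : Nat.card {g : G // g ≠ 1 ∧ rankMin U g < m} + 2 ≤ Nat.card {k // col k = i}) :
    ∃ q q', col q = i ∧ col q' = i ∧ m ≤ rankMin U ((α q')⁻¹ * α q) := by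
  classical
  have hne : Nonempty {k // col k = i} := (Nat.card_pos_iff.1 (by omega)).1
  obtain ⟨q, hq⟩ := hne
  by_contra! h
  have h1 : Nat.card {k : {k // col k = i} // k ≠ ⟨q, hq⟩} ≤
      Nat.card {g : G // g ≠ 1 ∧ rankMin U g < m} := by
    refine Nat.card_le_card_of_injective
      (fun k => ⟨(α k.1.1)⁻¹ * α q, fun h1 => k.2 (Subtype.ext (hinj _ _ k.1.2 hq ?_)),
        h q k.1.1 hq k.1.2⟩) fun k k' hk => ?_
    · exact inv_mul_eq_one.1 h1
    · have := inv_injective (mul_right_cancel (congrArg Subtype.val hk))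
      exact Subtype.ext (Subtype.ext (hinj _ _ k.1.2 k'.1.2 this))
  have h2 : Nat.card {k : {k // col k = i} // k ≠ ⟨q, hq⟩} + 1 = Nat.card {k // col k = i} := by
    have := Fintype.ofFinite {k // col k = i}
    rw [Nat.card_eq_fintype_card, Nat.card_eq_fintype_card, Fintype.card_subtype_compl,
      Fintype.card_subtype_eq]
    have : 0 < Fintype.card {k // col k = i} := Fintype.card_pos_iff.2 ⟨⟨q, hq⟩⟩
    omega
  omega

/-- For fixed choices of group elements, the set of `w` having a nontrivial solution of the
coincidence equations is small. -/
lemma polySmall_bad (hd : 2 ≤ d) (hdp : d ≤ p) (hp : p ≤ 2 * d) (hcol : Function.Surjective col)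
    (hinj : ∀ k k', col k = col k' → α k = α k' → k = k')
    (hcount : ∀ i : Fin p, (i : ℕ) < 2 * d - p →
      Nat.card {g : G // g ≠ 1 ∧ rankMin U g < 2 * d - p} + 2 ≤ Nat.card {k // col k = i}) :
    PolySmall {w : Fin p → Euc d | ∃ x y, Bad U col α β w x y} := by
  have hinj' : ∀ i k k', col k = i → col k' = i → α k = α k' → k = k' := by
    rintro i k k' rfl h2
    exact hinj k k' h2.symm
  have hpair : ∀ i : Fin p, ∃ q q', col q = i ∧ col q' = i ∧
      ((i : ℕ) < 2 * d - p → 2 * d - p ≤ rankMin U ((α q')⁻¹ * α q)) := by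
    intro i
    by_cases hi : (i : ℕ) < 2 * d - p
    · obtain ⟨q, q', h1, h2, h3⟩ := exists_pair_of_card (hinj' i) (hcount i hi)
      exact ⟨q, q', h1, h2, fun _ => h3⟩
    · obtain ⟨q, hq⟩ := hcol i
      exact ⟨q, q, hq, hq, fun h => absurd h hi⟩
  choose q₁ q₂ h₁ h₂ hrank using hpair
  have hmov : ∀ i₀ : {i : Fin p // (i : ℕ) < 2 * d - p},
      PolySmall {w : Fin p → Euc d | ∃ x y, Bad U col α β w x y ∧ ∃ c : ℝ,
        c ^ Fintype.card G ≠ 1 ∧ diffVec U α β (q₁ i₀) x y = c • diffVec U α β (q₂ i₀) x y} := by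
    rintro ⟨i₀, hi₀⟩
    rcases hdp.eq_or_lt with hp' | hp'
    · have hA := fun i : Fin p => polySmall_moving_ratio (U := U) (α := α) (β := β) hcol {i}
        (by simp [hp']) (q₁ i₀) (q₂ i₀)
      have hm : 2 * d - p = d := by omega
      rw [hm] at hcount hrank hi₀
      have hB := polySmall_parallel_columns (U := U) (α := α) (β := β) hd hdp hcol q₁ q₂ h₁ h₂
        (fun i => noEig_of_le_rankMin (hrank i (by omega))) i₀ (hinj' i₀)
        (by have := hcount i₀ hi₀; omega)
      refine ((PolySmall.iUnion hA).union hB).mono ?_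
      rintro w ⟨x, y, hbad, h⟩
      by_cases hex : ∃ i, NonParCol U col α β i x y
      · obtain ⟨i, hi⟩ := hex
        exact Or.inl (Set.mem_iUnion.2 ⟨i, x, y, hbad, h, by simpa using hi⟩)
      · push Not at hex
        exact Or.inr ⟨x, y, hbad, hex, h⟩
    · refine (polySmall_moving_ratio (U := U) (α := α) (β := β) hcol ∅ (by simpa using hp')
        (q₁ i₀) (q₂ i₀)).mono ?_
      rintro w ⟨x, y, hbad, h⟩
      exact ⟨x, y, hbad, h, by simp⟩
  have hfix := fun (c : ℝ) (i₀ : {i : Fin p // (i : ℕ) < 2 * d - p}) =>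
    polySmall_fixed_ratio (U := U) (α := α) (β := β) hcol hp (hrank i₀ i₀.2) c
  have hT : (Finset.univ.filter fun i : Fin p => (i : ℕ) < 2 * d - p).card = 2 * d - p := by
    rw [Fin.card_filter_val_lt]; omega
  have hall := polySmall_all_nonPar (U := U) (α := α) (β := β) hcol
    (Finset.univ.filter fun i : Fin p => (i : ℕ) < 2 * d - p) (by omega)
  refine (hall.union (PolySmall.iUnion fun i₀ =>
    (hmov i₀).union ((hfix 1 i₀).union (hfix (-1) i₀)))).mono ?_
  rintro w ⟨x, y, hbad⟩
  by_cases hex : ∀ i : Fin p, (i : ℕ) < 2 * d - p → NonParCol U col α β i x y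
  · exact Or.inl ⟨x, y, hbad, by simpa using hex⟩
  · push Not at hex
    obtain ⟨i₀, hi₀, hpar⟩ := hex
    refine Or.inr (Set.mem_iUnion.2 ⟨⟨i₀, hi₀⟩, ?_⟩)
    have h3 : Par (diffVec U α β (q₂ i₀) x y) (diffVec U α β (q₁ i₀) x y) := by
      by_contra h
      exact hpar ⟨_, _, h₂ i₀, h₁ i₀, h⟩
    obtain ⟨c, hc⟩ := h3.exists_smul (hbad _).1
    by_cases hcN : c ^ Fintype.card G = 1
    · rcases pow_eq_one_iff_cases.1 hcN with h | rfl | ⟨rfl, -⟩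
      · exact absurd h Fintype.card_ne_zero
      · exact Or.inr (Or.inl ⟨x, y, hbad, hc⟩)
      · exact Or.inr (Or.inr ⟨x, y, hbad, hc⟩)
    · exact Or.inl ⟨x, y, hbad, c, hcN, hc⟩

lemma countP_lt_getD_le {L : List ℕ} (hL : L.Pairwise (· ≤ ·)) (k : ℕ) :
    L.countP (fun a => decide (a < L.getD k 0)) ≤ k := by
  rcases lt_or_ge k L.length with hk | hk
  · conv_lhs => enter [2]; rw [← List.take_append_drop k L]
    rw [List.countP_append]
    have h1 : (L.drop k).countP (fun a => decide (a < L.getD k 0)) = 0 := by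
      rw [List.countP_eq_zero]
      intro a ha
      rw [List.getD_eq_getElem _ _ hk, decide_eq_true_eq, not_lt]
      obtain ⟨j, hj, rfl⟩ := List.mem_iff_getElem.1 ha
      rw [List.getElem_drop]
      rcases Nat.eq_zero_or_pos j with rfl | h0
      · simp
      · exact List.pairwise_iff_getElem.1 hL _ _ _ _ (by omega)
    have h2 := (List.countP_le_length (p := fun a => decide (a < L.getD k 0)) (l := L.take k))
    rw [List.length_take] at h2
    omega
  · rw [List.getD_eq_default _ _ hk]
    simp

lemma card_rankMin_lt [DecidableEq G] (k : ℕ) {m : ℕ} (hm : m ≤ (gammaSorted U).getD k 0) :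
    Nat.card {g : G // g ≠ 1 ∧ rankMin U g < m} ≤ k := by
  classical
  refine le_trans ?_ (countP_lt_getD_le
    (L := gammaSorted U) (Multiset.pairwise_sort _ _) k)
  rw [← Multiset.coe_countP, gammaSorted, Multiset.sort_eq, Multiset.countP_map,
    ← gammaSorted, ← Finset.filter_val, Finset.card_val, Finset.filter_filter,
    Nat.card_eq_fintype_card, Fintype.card_subtype]
  refine Finset.card_le_card fun g hg => ?_
  simp only [Finset.mem_filter, Finset.mem_univ, true_and] at hg ⊢
  exact ⟨hg.1, hg.2.trans_le hm⟩

lemma rankMin_le (g : G) : rankMin U g ≤ d := by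
  refine (rankMin_le_finrank_range g 0).trans ?_
  exact (Submodule.finrank_le _).trans_eq finrank_euclideanSpace_fin

lemma gammaSorted_getD_le [DecidableEq G] (k : ℕ) : (gammaSorted U).getD k 0 ≤ d := by
  rcases lt_or_ge k (gammaSorted U).length with hk | hk
  · rw [List.getD_eq_getElem _ _ hk]
    have h := List.getElem_mem hk
    obtain ⟨g, -, h⟩ := Multiset.mem_map.1 ((Multiset.mem_sort _).1 h)
    exact h.symm.trans_le (rankMin_le g)
  · rw [List.getD_eq_default _ _ hk]
    exact Nat.zero_le _

lemma exists_equiv_sort_eq (f : G → ℝ) : ∃ e : Fin (Fintype.card G) ≃ G,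
    (Finset.univ.val.map f).sort (· ≤ ·) = List.ofFn (f ∘ e) := by
  let e₀ := (Fintype.equivFin G).symm
  refine ⟨(Tuple.sort (f ∘ e₀)).trans e₀, ?_⟩
  have h1 : Finset.univ.val.map f =
      (List.ofFn (f ∘ (Tuple.sort (f ∘ e₀)).trans e₀) : Multiset ℝ) := by
    rw [← Fin.univ_val_map, ← Multiset.map_map, Multiset.map_univ_val_equiv]
  rw [h1, Multiset.coe_sort, List.mergeSort_eq_self]
  exact List.pairwise_ofFn.2 fun i j hij => Tuple.monotone_sort (f ∘ e₀) hij.le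

lemma exists_index_coorbit (w x : Euc d) : ∃ s : ℕ → G,
    Set.InjOn s (Set.Icc 1 (Fintype.card G)) ∧
    ∀ j ∈ Set.Icc 1 (Fintype.card G), coorbit U w x j = ⟪w, U (s j) x⟫ := by
  obtain ⟨e, he⟩ := exists_equiv_sort_eq fun g => ⟪U g w, x⟫
  refine ⟨fun j => if h : Fintype.card G - j < Fintype.card G then (e ⟨_, h⟩)⁻¹ else 1, ?_, ?_⟩
  · intro j hj j' hj' h
    rw [Set.mem_Icc] at hj hj'
    beta_reduce at h
    rw [dif_pos (by omega), dif_pos (by omega)] at h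
    have := e.injective (inv_injective h)
    rw [Fin.mk.injEq] at this
    omega
  · intro j hj
    rw [Set.mem_Icc] at hj
    have hlt : Fintype.card G - j < Fintype.card G := by omega
    beta_reduce
    rw [dif_pos hlt, coorbit, he, List.getD_eq_getElem _ _ (by simpa using hlt),
      List.getElem_ofFn]
    rw [← (U (e ⟨_, hlt⟩)).inner_map_map w, act_act_inv]
    rfl

lemma coorbit_act (g : G) (w x : Euc d) (j : ℕ) : coorbit U w (U g x) j = coorbit U w x j := by
  have h : Finset.univ.val.map (fun h : G => ⟪U h w, U g x⟫) =
      Finset.univ.val.map (fun h : G => ⟪U h w, x⟫) := by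
    have h1 : (fun h : G => ⟪U h w, U g x⟫) =
        (fun h : G => ⟪U h w, x⟫) ∘ (Equiv.mulLeft g⁻¹) := by
      funext h
      simp only [Function.comp_apply, Equiv.coe_mulLeft]
      rw [← (U g).inner_map_map (U (g⁻¹ * h) w), ← act_mul, mul_inv_cancel_left]
    rw [h1, ← Multiset.map_map, Multiset.map_univ_val_equiv]
  rw [coorbit, h, coorbit]

end Orbits

/-- Theorem 3.6: with `γ` the decreasing rearrangement of
`{min_λ rank(U_g − λI) : g ≠ 1}` and `p_n = 2d − γ_{N−n+1}`, if `p_n ≤ p ≤ 2d` and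
`S ⊆ {1,…,N} × {1,…,p}` has `|S_i| = n` for the first `2d − p` columns and `|S_i| = 1`
for the remaining ones, then the bad set of tuples `w ∈ V^p` whose coorbit map
`x ↦ (Φ_{w_i,j}(x))_{(j,i) ∈ S}` fails to separate `G`-orbits has Lebesgue measure zero
and is nowhere dense; consequently, for every `w` outside it, the coorbit map takes equal
values at `x, y` iff `x ∼ y`. -/
theorem stmt13 {d : ℕ} (hd : 2 ≤ d) {G : Type} [Group G] [Fintype G] [DecidableEq G]
    (U : G →* (EuclideanSpace ℝ (Fin d) ≃ₗᵢ[ℝ] EuclideanSpace ℝ (Fin d)))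
    (n p : ℕ) (hn2 : 2 ≤ n) (hnN : n ≤ Fintype.card G - 1)
    (hpn : 2 * d - (gammaSorted U).getD (n - 2) 0 ≤ p) (hp2d : p ≤ 2 * d)
    (S : Finset (ℕ × Fin p))
    (hS : ∀ q ∈ S, q.1 ∈ Finset.Icc 1 (Fintype.card G))
    (hScard1 : ∀ i : Fin p, (i : ℕ) < 2 * d - p → (S.filter fun q => q.2 = i).card = n)
    (hScard2 : ∀ i : Fin p, 2 * d - p ≤ (i : ℕ) → (S.filter fun q => q.2 = i).card = 1)
    (F : Set (Fin p → EuclideanSpace ℝ (Fin d)))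
    (hF : F = {w : Fin p → EuclideanSpace ℝ (Fin d) | ∃ x y : EuclideanSpace ℝ (Fin d),
      (¬∃ g : G, (U g) x = y) ∧
      ∀ q ∈ S, coorbit U (w q.2) x q.1 = coorbit U (w q.2) y q.1}) :
    volume F = 0 ∧ IsNowhereDense F ∧
    ∀ w ∉ F, ∀ x y : EuclideanSpace ℝ (Fin d),
      (∀ q ∈ S, coorbit U (w q.2) x q.1 = coorbit U (w q.2) y q.1) ↔
      (∃ g : G, (U g) x = y) := by
  subst hF
  have hγ := gammaSorted_getD_le (U := U) (n - 2)
  have hpos : 0 < Fintype.card G := Fintype.card_pos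
  have hne : ∀ i : Fin p, (S.filter fun q => q.2 = i).Nonempty := by
    intro i
    rw [← Finset.card_pos]
    rcases lt_or_ge (i : ℕ) (2 * d - p) with h | h
    · rw [hScard1 i h]; omega
    · rw [hScard2 i h]; exact one_pos
  let col : S → Fin p := fun q => q.1.2
  have hcol : Function.Surjective col := by
    intro i
    obtain ⟨q, hq⟩ := hne i
    rw [Finset.mem_filter] at hq
    exact ⟨⟨q, hq.1⟩, hq.2⟩
  have : Nonempty S := ⟨(hcol ⟨0, by omega⟩).choose⟩
  have hcount : ∀ i : Fin p, (i : ℕ) < 2 * d - p →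
      Nat.card {g : G // g ≠ 1 ∧ rankMin U g < 2 * d - p} + 2 ≤ Nat.card {k // col k = i} := by
    intro i hi
    have h1 := card_rankMin_lt (U := U) (n - 2) (m := 2 * d - p) (by omega)
    have h2 : Nat.card {k // col k = i} = n := by
      rw [← hScard1 i hi, ← Nat.card_eq_finsetCard]
      exact Nat.card_congr
        { toFun := fun k => ⟨k.1.1, Finset.mem_filter.2 ⟨k.1.2, k.2⟩⟩
          invFun := fun q => ⟨⟨q.1, (Finset.mem_filter.1 q.2).1⟩, (Finset.mem_filter.1 q.2).2⟩
          left_inv := fun _ => rfl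
          right_inv := fun _ => rfl }
    omega
  have hsmall := PolySmall.iUnion fun e : {e : (S → G) × (S → G) //
      ∀ k k', col k = col k' → e.1 k = e.1 k' → k = k'} =>
    polySmall_bad (U := U) (β := e.1.2) hd (by omega) hp2d hcol e.2 hcount
  have hmain := (hsmall.mono (F := {w : Fin p → EuclideanSpace ℝ (Fin d) |
    ∃ x y : EuclideanSpace ℝ (Fin d), (¬∃ g : G, (U g) x = y) ∧
      ∀ q ∈ S, coorbit U (w q.2) x q.1 = coorbit U (w q.2) y q.1}) ?_).null_and_nowhereDense
  · refine ⟨hmain.1, hmain.2, fun w hw x y => ⟨fun h => ?_, ?_⟩⟩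
    · by_contra hxy
      exact hw ⟨x, y, hxy, h⟩
    · rintro ⟨g, rfl⟩ q -
      exact (coorbit_act g _ _ _).symm
  · rintro w ⟨x, y, hxy, h⟩
    choose s hs hsx using fun i => exists_index_coorbit (U := U) (w i) x
    choose t _ hty using fun i => exists_index_coorbit (U := U) (w i) y
    have hmem : ∀ q : S, q.1.1 ∈ Set.Icc 1 (Fintype.card G) := fun q =>
      Finset.mem_Icc.1 (hS q.1 q.2)
    refine Set.mem_iUnion.2 ⟨⟨(fun q => s q.1.2 q.1.1, fun q => t q.1.2 q.1.1), ?_⟩, x, y,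
      fun q => ⟨fun h0 => hxy ?_, ?_⟩⟩
    · intro k k' hk he
      have hk' : k.1.2 = k'.1.2 := hk
      replace he : s k.1.2 k.1.1 = s k'.1.2 k'.1.1 := he
      rw [← hk'] at he
      exact Subtype.ext (Prod.ext (hs _ (hmem k) (hmem k') he) hk')
    · refine ⟨(t q.1.2 q.1.1)⁻¹ * s q.1.2 q.1.1, ?_⟩
      rw [act_mul, sub_eq_zero.1 h0, act_inv_act]
    · have h1 := h q.1 q.2
      rw [hsx _ _ (hmem q), hty _ _ (hmem q)] at h1
      rw [diffVec, inner_sub_right]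
      exact sub_eq_zero.2 h1
end
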